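/- arXiv:1304.1205 — 11 statements merged into one kernel-verified Lean document; each statement's English description precedes it below -/
import Mathlib

section
/- For any finite simple graph G, q(G) ≤ cc(G) + 1, where cc(G) is the clique covering number of G. -/
/-- `S(G)`: real symmetric matrices whose off-diagonal zero-nonzero pattern is given by `G`. -/
def SMat {V : Type*} [Fintype V] [DecidableEq V] (G : SimpleGraph V)
    (A : Matrix V V ℝ) : Prop :=
  A.IsSymm ∧ ∀ i j : V, i ≠ j → (A i j ≠ 0 ↔ G.Adj i j)

/-- `q(A)`: the number of distinct (real) eigenvalues of `A`. -/
noncomputable def qMat {V : Type*} [Fintype V] [DecidableEq V] (A : Matrix V V ℝ) : ℕ :=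
  (spectrum ℝ A).ncard

/-- `q(G)`: the minimum number of distinct eigenvalues over matrices in `S(G)`. -/
noncomputable def qGraph {V : Type*} [Fintype V] [DecidableEq V] (G : SimpleGraph V) : ℕ :=
  sInf {k | ∃ A : Matrix V V ℝ, SMat G A ∧ qMat A = k}

/-- `cc(G)`: the minimum number of cliques needed to cover all edges of `G`. -/
noncomputable def ccNum {V : Type*} [Fintype V] [DecidableEq V] (G : SimpleGraph V) : ℕ :=
  sInf {k | ∃ F : Finset (Finset V), F.card = k ∧
    (∀ c ∈ F, G.IsClique (c : Set V)) ∧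
    ∀ u v : V, G.Adj u v → ∃ c ∈ F, u ∈ c ∧ v ∈ c}

theorem Matrix.IsHermitian.ncard_spectrum_le_rank_add_one {n : Type*} [Fintype n] [DecidableEq n]
    {A : Matrix n n ℝ} (hA : A.IsHermitian) : (spectrum ℝ A).ncard ≤ A.rank + 1 := by
  have hsub : spectrum ℝ A ⊆
      insert 0 (Set.range fun i : {i // hA.eigenvalues i ≠ 0} => hA.eigenvalues i) := by
    rw [hA.spectrum_real_eq_range_eigenvalues]
    rintro _ ⟨i, rfl⟩
    by_cases hi : hA.eigenvalues i = 0
    · exact Or.inl hi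
    · exact Or.inr ⟨⟨i, hi⟩, rfl⟩
  calc (spectrum ℝ A).ncard ≤ _ := Set.ncard_le_ncard hsub (Set.toFinite _)
    _ ≤ _ := Set.ncard_insert_le _ _
    _ ≤ A.rank + 1 := by
      rw [hA.rank_eq_card_non_zero_eigs, ← Nat.card_eq_fintype_card, ← Nat.card_coe_set_eq]
      exact Nat.add_le_add_right (Finite.card_range_le _) 1

/-- The Gram matrix of a clique covering of `G` lies in `S(G)`, and its rank is at most the number
of cliques. -/
theorem exists_sMat_rank_le_card {V : Type*} [Fintype V] [DecidableEq V] {G : SimpleGraph V}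
    {F : Finset (Finset V)} (hclique : ∀ c ∈ F, G.IsClique (c : Set V))
    (hcover : ∀ u v : V, G.Adj u v → ∃ c ∈ F, u ∈ c ∧ v ∈ c) :
    ∃ A : Matrix V V ℝ, SMat G A ∧ A.rank ≤ F.card := by
  let M : Matrix V F ℝ := Matrix.of fun v c => if v ∈ c.1 then 1 else 0
  refine ⟨M * M.transpose, ⟨by simp [Matrix.IsSymm], fun i j hij => ?_⟩, ?_⟩
  · have hnonneg : ∀ c ∈ Finset.univ, 0 ≤ M i c * M j c := fun c _ => by
      simp only [M, Matrix.of_apply]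
      positivity
    rw [Matrix.mul_apply]
    simp only [Matrix.transpose_apply]
    rw [Ne, Finset.sum_eq_zero_iff_of_nonneg hnonneg]
    constructor
    · intro h
      push Not at h
      obtain ⟨c, -, hc⟩ := h
      have hmem : i ∈ c.1 ∧ j ∈ c.1 := by simpa [M, and_comm] using hc
      exact hclique c.1 c.2 hmem.1 hmem.2 hij
    · intro hadj h
      obtain ⟨c, hc, hi, hj⟩ := hcover i j hadj
      simpa [M, hi, hj] using h ⟨c, hc⟩ (Finset.mem_univ _)
  · calc (M * M.transpose).rank ≤ M.rank := Matrix.rank_mul_le_left _ _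
      _ ≤ Fintype.card F := M.rank_le_card_width
      _ = F.card := Fintype.card_coe F

theorem exists_clique_cover_card_eq_ccNum {V : Type*} [Fintype V] [DecidableEq V]
    (G : SimpleGraph V) :
    ∃ F : Finset (Finset V), F.card = ccNum G ∧
      (∀ c ∈ F, G.IsClique (c : Set V)) ∧
      ∀ u v : V, G.Adj u v → ∃ c ∈ F, u ∈ c ∧ v ∈ c := by
  classical
  refine Nat.sInf_mem (s := {k | ∃ F : Finset (Finset V), F.card = k ∧
    (∀ c ∈ F, G.IsClique (c : Set V)) ∧
    ∀ u v : V, G.Adj u v → ∃ c ∈ F, u ∈ c ∧ v ∈ c})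
    ⟨_, Finset.univ.filter fun c : Finset V => G.IsClique (c : Set V), rfl,
      fun c hc => (Finset.mem_filter.mp hc).2, fun u v huv => ⟨{u, v}, ?_, by simp, by simp⟩⟩
  simp [huv]

/-- For any finite simple graph `G`, `q(G) ≤ cc(G) + 1`. -/
theorem stmt_2 {V : Type*} [Fintype V] [DecidableEq V] (G : SimpleGraph V) :
    qGraph G ≤ ccNum G + 1 := by
  obtain ⟨F, hcard, hclique, hcover⟩ := exists_clique_cover_card_eq_ccNum G
  obtain ⟨A, hA, hrank⟩ := exists_sMat_rank_le_card hclique hcover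
  have hherm : A.IsHermitian := by
    rw [Matrix.IsHermitian, Matrix.conjTranspose_eq_transpose_of_trivial]
    exact hA.1
  calc qGraph G ≤ qMat A := Nat.sInf_le ⟨A, hA, rfl⟩
    _ ≤ A.rank + 1 := hherm.ncard_spectrum_le_rank_add_one
    _ ≤ ccNum G + 1 := by omega
end

section
/- For every integer n ≥ 3, the cycle C_n on n vertices satisfies q(C_n) = ⌈n/2⌉. -/
/-- The cycle graph on `n` vertices `0, 1, ..., n-1`, with `i` adjacent to `j`
exactly when `i - j ≡ ± 1 (mod n)`. -/
def cycleG (n : ℕ) : SimpleGraph (Fin n) :=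
  SimpleGraph.fromRel (fun i j => (i.val + 1) % n = j.val)

theorem cycleG_adj_succ {n : ℕ} (k : ℕ) (h : k + 1 < n) :
    (cycleG n).Adj ⟨k, by omega⟩ ⟨k + 1, h⟩ := by
  simp [cycleG, Nat.mod_eq_of_lt h]

theorem not_cycleG_adj {n k : ℕ} (j : Fin n) (hk : 0 < k) (h : k + 1 < j) :
    ¬ (cycleG n).Adj ⟨k, by omega⟩ j := by
  have hj := j.isLt
  simp only [cycleG, SimpleGraph.fromRel_adj, not_and, not_or]
  intro _
  rw [Nat.mod_eq_of_lt (by omega : k + 1 < n)]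
  refine ⟨by omega, fun h2 => ?_⟩
  rcases Nat.lt_or_ge (j.val + 1) n with h3 | h3
  · rw [Nat.mod_eq_of_lt h3] at h2
    omega
  · rw [show j.val + 1 = n by omega, Nat.mod_self] at h2
    omega

/-- An eigenvector of a matrix in `S(C_n)` vanishing at two consecutive vertices is zero. -/
theorem SMat.eq_zero_of_mulVec_eq_smul {n : ℕ} (hn : 3 ≤ n) {A : Matrix (Fin n) (Fin n) ℝ}
    (hA : SMat (cycleG n) A) {μ : ℝ} {v : Fin n → ℝ} (hv : A.mulVec v = μ • v)
    (h0 : v ⟨0, by omega⟩ = 0) (h1 : v ⟨1, by omega⟩ = 0) : v = 0 := by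
  suffices H : ∀ k (hk : k < n), v ⟨k, hk⟩ = 0 by
    ext i
    exact H i i.isLt
  intro k
  induction k using Nat.strong_induction_on with
  | _ k ih =>
    intro hk
    match k, ih, hk with
    | 0, _, _ => exact h0
    | 1, _, _ => exact h1
    | k + 2, ih, hk =>
      have hrow := congrFun hv ⟨k + 1, by omega⟩
      rw [Pi.smul_apply, ih (k + 1) (by omega) (by omega), smul_zero, Matrix.mulVec, dotProduct,
        Finset.sum_eq_single ⟨k + 2, hk⟩ _ (by simp)] at hrow
      · refine (mul_eq_zero.1 hrow).resolve_left ?_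
        exact (hA.2 _ _ (by simp)).2 (cycleG_adj_succ (k + 1) hk)
      · intro j _ hj
        rcases Nat.lt_or_ge j.val (k + 2) with h | h
        · rw [ih j h j.isLt, mul_zero]
        · have hlt : k + 1 + 1 < j.val := by
            have : j.val ≠ k + 2 := fun h => hj (Fin.ext h)
            omega
          have hne : (⟨k + 1, by omega⟩ : Fin n) ≠ j := by
            intro h
            have := congrArg Fin.val h
            simp only at this
            omega
          have : A ⟨k + 1, by omega⟩ j = 0 := by
            by_contra hc
            exact not_cycleG_adj j (by omega) hlt ((hA.2 _ _ hne).1 hc)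
          rw [this, zero_mul]

theorem SMat.finrank_eigenspace_le_two {n : ℕ} (hn : 3 ≤ n) {A : Matrix (Fin n) (Fin n) ℝ}
    (hA : SMat (cycleG n) A) (μ : ℝ) :
    Module.finrank ℝ (Module.End.eigenspace (Matrix.toLin' A) μ) ≤ 2 := by
  let f : Module.End.eigenspace (Matrix.toLin' A) μ →ₗ[ℝ] (Fin 2 → ℝ) :=
    (LinearMap.funLeft ℝ ℝ (![⟨0, by omega⟩, ⟨1, by omega⟩] : Fin 2 → Fin n)).comp
      (Submodule.subtype _)
  have hf : Function.Injective f := by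
    rw [← LinearMap.ker_eq_bot, LinearMap.ker_eq_bot']
    rintro ⟨v, hv⟩ h
    rw [Module.End.mem_eigenspace_iff, Matrix.toLin'_apply] at hv
    have h0 := congrFun h 0
    have h1 := congrFun h 1
    simp only [f, LinearMap.comp_apply, Submodule.subtype_apply, LinearMap.funLeft_apply,
      Matrix.cons_val_zero, Matrix.cons_val_one, Pi.zero_apply] at h0 h1
    exact Subtype.ext (hA.eq_zero_of_mulVec_eq_smul hn hv h0 h1)
  simpa using LinearMap.finrank_le_finrank_of_injective hf

theorem SMat.le_two_mul_qMat {n : ℕ} (hn : 3 ≤ n) {A : Matrix (Fin n) (Fin n) ℝ}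
    (hA : SMat (cycleG n) A) : n ≤ 2 * qMat A := by
  classical
  have hH : A.IsHermitian := by
    rw [Matrix.IsHermitian, Matrix.conjTranspose_eq_transpose_of_trivial]
    exact hA.1
  have hq : qMat A = (Finset.univ.image hH.eigenvalues).card := by
    rw [qMat, hH.spectrum_real_eq_range_eigenvalues, ← Set.ncard_coe_finset]
    simp
  rw [hq]
  have := Finset.card_le_mul_card_image (f := hH.eigenvalues) (Finset.univ : Finset (Fin n)) 2 ?_
  · simpa using this
  intro μ _
  let w : {i // hH.eigenvalues i = μ} → Module.End.eigenspace (Matrix.toLin' A) μ :=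
    fun i => ⟨(hH.eigenvectorBasis i.1).ofLp, by
      rw [Module.End.mem_eigenspace_iff, Matrix.toLin'_apply, hH.mulVec_eigenvectorBasis, i.2]⟩
  have hw : LinearIndependent ℝ w := by
    apply LinearIndependent.of_comp (Submodule.subtype _)
    have h := hH.eigenvectorBasis.orthonormal.linearIndependent.map'
      (WithLp.linearEquiv 2 ℝ (Fin n → ℝ)).toLinearMap (LinearEquiv.ker _)
    exact h.comp _ Subtype.val_injective
  have h := hw.fintype_card_le_finrank.trans (hA.finrank_eigenspace_le_two hn μ)
  rwa [Fintype.card_subtype] at h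

/-- The adjacency matrix of `C_n` with the sign of the edge `{0, n - 1}` reversed. -/
def signedCycleMatrix (n : ℕ) : Matrix (Fin n) (Fin n) ℝ := fun i j =>
  (if j.val = i.val + 1 then 1 else 0) + (if j.val + 1 = i.val then 1 else 0) -
    (if i.val = 0 ∧ j.val + 1 = n then 1 else 0) - (if i.val + 1 = n ∧ j.val = 0 then 1 else 0)

theorem sMat_signedCycleMatrix {n : ℕ} (hn : 3 ≤ n) :
    SMat (cycleG n) (signedCycleMatrix n) := by
  constructor
  · ext i j
    simp only [Matrix.transpose_apply, signedCycleMatrix]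
    grind
  · intro i j hij
    have hi := i.isLt
    have hj := j.isLt
    have hij' : i.val ≠ j.val := fun h => hij (Fin.ext h)
    have key : ∀ k < n, (k + 1) % n = if k + 1 = n then 0 else k + 1 := by
      intro k hk
      split_ifs with h
      · rw [h, Nat.mod_self]
      · exact Nat.mod_eq_of_lt (by omega)
    simp only [cycleG, SimpleGraph.fromRel_adj, signedCycleMatrix, key _ hi, key _ hj]
    grind

/-- Nonzero solutions of `x (k + 2) + x k = μ x (k + 1)` with antiperiod `n` come from roots of
the characteristic equation that are `n`-th roots of `-1`. -/
theorem pow_eq_neg_one_of_antiperiodic {n : ℕ} {μ z : ℂ} (hz : z ^ 2 + 1 = μ * z) {x : ℕ → ℂ}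
    (hx : ∀ k < n, x (k + 2) + x k = μ * x (k + 1)) (h0 : x n = -x 0) (h1 : x (n + 1) = -x 1)
    (hne : ¬ (x 0 = 0 ∧ x 1 = 0)) : z ^ n = -1 := by
  have hw : ∀ k ≤ n, z ^ k * (x (k + 1) - z * x k) = x 1 - z * x 0 := by
    intro k
    induction k with
    | zero => simp
    | succ k ih =>
      intro hk
      rw [← ih (by omega)]
      linear_combination z ^ (k + 1) * hx k (by omega) - z ^ k * x (k + 1) * hz
  by_cases hc : x 1 - z * x 0 = 0
  · have hz0 : z ≠ 0 := by
      rintro rfl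
      norm_num at hz
    have hp : ∀ k ≤ n, x k = z ^ k * x 0 := by
      intro k
      induction k with
      | zero => simp
      | succ k ih =>
        intro hk
        have h := hw k (by omega)
        rw [hc] at h
        have h' := (mul_eq_zero.1 h).resolve_left (pow_ne_zero _ hz0)
        linear_combination h' + z * ih (by omega)
    have hx0 : x 0 ≠ 0 := by
      intro h
      refine hne ⟨h, ?_⟩
      simpa [h] using hc
    apply mul_right_cancel₀ hx0
    rw [← hp n le_rfl, h0]
    ring
  · apply mul_right_cancel₀ hc
    linear_combination -(hw n le_rfl) + z ^ n * h1 - z ^ (n + 1) * h0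

theorem exists_eq_two_mul_cos {n : ℕ} (hn : n ≠ 0) {μ : ℝ} {z : ℂ}
    (hz : z ^ 2 + 1 = (μ : ℂ) * z) (hzn : z ^ n = -1) :
    ∃ j < (n + 1) / 2, μ = 2 * Real.cos ((2 * j + 1) * Real.pi / n) := by
  have hn' : (n : ℂ) ≠ 0 := Nat.cast_ne_zero.2 hn
  have hnR : (n : ℝ) ≠ 0 := Nat.cast_ne_zero.2 hn
  set w : ℂ := Complex.exp (Real.pi * Complex.I / n) with hw
  have hw0 : w ≠ 0 := Complex.exp_ne_zero _
  have hwn : w ^ n = -1 := by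
    rw [hw, ← Complex.exp_nat_mul, mul_div_cancel₀ _ hn', Complex.exp_pi_mul_I]
  have : NeZero n := ⟨hn⟩
  obtain ⟨j, hj, hjz⟩ := (Complex.isPrimitiveRoot_exp n hn).eq_pow_of_pow_eq_one
    (ξ := z / w) (by rw [div_pow, hzn, hwn]; norm_num)
  have hze : z = Complex.exp (((2 * j + 1) * Real.pi / n : ℝ) * Complex.I) := by
    rw [eq_div_iff hw0, hw, ← Complex.exp_nat_mul, ← Complex.exp_add] at hjz
    rw [← hjz]
    congr 1
    push_cast
    field_simp
  have hμ : μ = 2 * Real.cos ((2 * j + 1) * Real.pi / n) := by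
    have hz0 : z ≠ 0 := hze ▸ Complex.exp_ne_zero _
    have h : (μ : ℂ) = z + z⁻¹ := by
      field_simp
      linear_combination -hz
    rw [hze, ← Complex.exp_neg, ← neg_mul, ← Complex.two_cos] at h
    exact_mod_cast h
  rcases Nat.lt_or_ge j ((n + 1) / 2) with h | h
  · exact ⟨j, h, hμ⟩
  · refine ⟨n - 1 - j, by omega, ?_⟩
    rw [hμ, ← Real.cos_two_pi_sub]
    congr 2
    have : ((n - 1 - j : ℕ) : ℝ) = n - 1 - j := by
      rw [Nat.cast_sub (by omega), Nat.cast_sub (by omega), Nat.cast_one]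
    rw [this]
    field_simp
    ring

theorem signedCycleMatrix_eigenvalue {n : ℕ} (hn : 3 ≤ n) {μ : ℝ} {v : Fin n → ℝ} (hv0 : v ≠ 0)
    (hv : (signedCycleMatrix n).mulVec v = μ • v) :
    ∃ j < (n + 1) / 2, μ = 2 * Real.cos ((2 * j + 1) * Real.pi / n) := by
  let y : ℕ → ℝ := fun k => if h : k < n then v ⟨k, h⟩ else 0
  have hy : ∀ i : Fin n, v i = y i := fun i => by simp [y]
  have hrow : ∀ k < n, μ * y k = (if k + 1 < n then y (k + 1) else 0) +
      (if 0 < k then y (k - 1) else 0) - (if k = 0 then y (n - 1) else 0) -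
      (if k + 1 = n then y 0 else 0) := by
    intro k hk
    have h := congrFun hv ⟨k, hk⟩
    simp only [Matrix.mulVec, dotProduct, signedCycleMatrix, hy, Pi.smul_apply, smul_eq_mul] at h
    rw [Fin.sum_univ_eq_sum_range (fun j => ((if j = k + 1 then (1 : ℝ) else 0) +
      (if j + 1 = k then 1 else 0) - (if k = 0 ∧ j + 1 = n then 1 else 0) -
      (if k + 1 = n ∧ j = 0 then 1 else 0)) * y j)] at h
    rw [← h]
    simp only [sub_mul, add_mul, Finset.sum_add_distrib, Finset.sum_sub_distrib, ite_mul, one_mul,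
      zero_mul]
    congr 1
    · congr 1
      · congr 1
        · simp
        · rcases k with _ | k
          · simp
          · simp [show k < n by omega]
      · by_cases hk0 : k = 0
        · rw [Finset.sum_eq_single (n - 1)]
          · simp [hk0, show n - 1 + 1 = n by omega]
          · intro b _ hb
            rw [if_neg (by omega)]
          · simp; omega
        · simp [hk0]
    · by_cases hkn : k + 1 = n
      · simp [hkn, show 0 < n by omega]
      · simp [hkn]
  let x : ℕ → ℝ := fun k => if k < n then y k else -y (k - n)
  have hx : ∀ k < n, x (k + 2) + x k = μ * x (k + 1) := by
    intro k hk
    rcases Nat.lt_or_ge (k + 1) n with h | h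
    · have hr := hrow (k + 1) h
      simp only [x, if_pos h, if_pos hk]
      rw [hr]
      rcases Nat.lt_or_ge (k + 2) n with h2 | h2
      · simp [h2, show k + 1 + 1 ≠ n by omega]
      · simp [show k + 2 = n by omega]
        ring
    · have hr := hrow 0 (by omega)
      obtain rfl : n = k + 1 := by omega
      simp [show k ≠ 0 by omega, show 0 < k by omega] at hr
      simp [x]
      linarith
  have hne : ¬ (x 0 = 0 ∧ x 1 = 0) := by
    rintro ⟨h0, h1⟩
    simp only [x, if_pos (show 0 < n by omega), if_pos (show 1 < n by omega)] at h0 h1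
    exact hv0 ((sMat_signedCycleMatrix hn).eq_zero_of_mulVec_eq_smul hn hv
      (by rw [hy]; exact h0) (by rw [hy]; exact h1))
  obtain ⟨z, hz⟩ : ∃ z : ℂ, z ^ 2 + 1 = (μ : ℂ) * z := by
    obtain ⟨s, hs⟩ := IsAlgClosed.exists_pow_nat_eq ((μ : ℂ) ^ 2 - 4) two_pos
    refine ⟨(μ + s) / 2, ?_⟩
    linear_combination hs / 4
  refine exists_eq_two_mul_cos (by omega) hz
    (pow_eq_neg_one_of_antiperiodic (x := fun k => (x k : ℂ)) hz ?_ ?_ ?_ ?_)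
  · intro k hk
    exact_mod_cast hx k hk
  · simp [x, show 0 < n by omega]
  · simp [x, show 1 < n by omega]
  · exact_mod_cast hne

theorem qMat_signedCycleMatrix_le {n : ℕ} (hn : 3 ≤ n) :
    qMat (signedCycleMatrix n) ≤ (n + 1) / 2 := by
  classical
  have hsub : spectrum ℝ (signedCycleMatrix n) ⊆ ((Finset.range ((n + 1) / 2)).image
      fun j : ℕ => 2 * Real.cos ((2 * j + 1) * Real.pi / n) : Finset ℝ) := by
    intro μ hμ
    rw [← Matrix.spectrum_toLin', ← Module.End.hasEigenvalue_iff_mem_spectrum] at hμ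
    obtain ⟨v, hv⟩ := hμ.exists_hasEigenvector
    have h := hv.apply_eq_smul
    rw [Matrix.toLin'_apply] at h
    obtain ⟨j, hj, hjμ⟩ := signedCycleMatrix_eigenvalue hn hv.2 h
    simp only [Finset.coe_image, Set.mem_image, Finset.mem_coe, Finset.mem_range]
    exact ⟨j, hj, hjμ.symm⟩
  refine (Set.ncard_le_ncard hsub (Finset.finite_toSet _)).trans ?_
  rw [Set.ncard_coe_finset]
  exact Finset.card_image_le.trans (by simp)

/-- For every `n ≥ 3`, `q(C_n) = ⌈n/2⌉`. -/
theorem stmt_3 (n : ℕ) (hn : 3 ≤ n) : qGraph (cycleG n) = (n + 1) / 2 := by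
  apply le_antisymm
  · refine le_trans (Nat.sInf_le ?_) (qMat_signedCycleMatrix_le hn)
    exact ⟨_, sMat_signedCycleMatrix hn, rfl⟩
  · refine le_csInf ⟨_, _, sMat_signedCycleMatrix hn, rfl⟩ ?_
    rintro _ ⟨A, hA, rfl⟩
    have := hA.le_two_mul_qMat hn
    omega
end

section
/- For a finite simple graph G on n vertices, q(G) = n if and only if G is a path (that is, G is isomorphic to the path graph P_n, the graph on vertices 1,...,n with i adjacent to j exactly when |i − j| = 1). -/
/-- The path graph on `n` vertices `0, 1, ..., n-1`, with `i` adjacent to `j`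
exactly when `|i - j| = 1`. -/
def pathG (n : ℕ) : SimpleGraph (Fin n) :=
  SimpleGraph.fromRel (fun i j => i.val + 1 = j.val)

theorem eigenvalues_injective_iff_qMat {V : Type*} [Fintype V] [DecidableEq V] {A : Matrix V V ℝ}
    (hA : A.IsHermitian) : Function.Injective hA.eigenvalues ↔ qMat A = Fintype.card V := by
  rw [qMat, hA.spectrum_real_eq_range_eigenvalues, ← Set.image_univ, Fintype.card_eq_nat_card,
    ← Set.ncard_univ, Set.ncard_image_iff, Set.injOn_univ]

open Matrix in
/-- A real symmetric matrix with only one-dimensional eigenspaces has a simple spectrum. -/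
theorem qMat_eq_card_of_eigenvectors_dependent {V : Type*} [Fintype V] [DecidableEq V]
    {A : Matrix V V ℝ} (hA : A.IsSymm)
    (h : ∀ (μ : ℝ) (x y : V → ℝ), A *ᵥ x = μ • x → A *ᵥ y = μ • y →
      ¬ LinearIndependent ℝ ![x, y]) : qMat A = Fintype.card V := by
  have hH : A.IsHermitian := by
    rw [IsHermitian, conjTranspose_eq_transpose_of_trivial, hA]
  rw [← eigenvalues_injective_iff_qMat hH]
  intro i j hij
  by_contra hne
  refine h _ _ _ (hH.mulVec_eigenvectorBasis i) (hij ▸ hH.mulVec_eigenvectorBasis j) ?_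
  have hl := hH.eigenvectorBasis.toBasis.linearIndependent.map'
    (WithLp.linearEquiv 2 ℝ (V → ℝ)).toLinearMap (LinearEquiv.ker _)
  have := hl.comp ![i, j] (by
    intro a b; fin_cases a <;> fin_cases b <;> simp [hne, Ne.symm hne])
  have he : ![⇑(hH.eigenvectorBasis i), ⇑(hH.eigenvectorBasis j)] =
      (WithLp.linearEquiv 2 ℝ (V → ℝ) ∘ hH.eigenvectorBasis.toBasis) ∘ ![i, j] := by
    ext a b
    fin_cases a <;> simp
  rw [he]
  exact this

open Matrix in
/-- A real symmetric matrix with nullity at least two has a repeated eigenvalue. -/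
theorem qMat_lt_card_of_linearIndependent_ker {V : Type*} [Fintype V] [DecidableEq V]
    {A : Matrix V V ℝ} (hA : A.IsSymm) {x y : V → ℝ} (hx : A *ᵥ x = 0) (hy : A *ᵥ y = 0)
    (hxy : LinearIndependent ℝ ![x, y]) : qMat A < Fintype.card V := by
  have hH : A.IsHermitian := by
    rw [IsHermitian, conjTranspose_eq_transpose_of_trivial, hA]
  have hle : qMat A ≤ Fintype.card V := by
    rw [qMat, hH.spectrum_real_eq_range_eigenvalues, ← Set.image_univ, Fintype.card_eq_nat_card,
      ← Set.ncard_univ]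
    exact Set.ncard_image_le
  refine lt_of_le_of_ne hle fun heq => ?_
  have hinj := (eigenvalues_injective_iff_qMat hH).2 heq
  have hrank := hH.rank_eq_card_non_zero_eigs
  have hker : 2 ≤ Module.finrank ℝ (LinearMap.ker A.mulVecLin) := by
    have hspan : Submodule.span ℝ (Set.range ![x, y]) ≤ LinearMap.ker A.mulVecLin := by
      rw [Submodule.span_le]
      rintro _ ⟨a, rfl⟩
      fin_cases a <;> simp [hx, hy]
    have := Submodule.finrank_mono hspan
    rwa [finrank_span_eq_card hxy, Fintype.card_fin] at this
  have hrn := A.mulVecLin.finrank_range_add_finrank_ker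
  rw [Module.finrank_fintype_fun_eq_card] at hrn
  have hz : Fintype.card {i // ¬ hH.eigenvalues i ≠ 0} ≤ 1 := by
    rw [Fintype.card_le_one_iff_subsingleton]
    refine ⟨fun a b => Subtype.ext (hinj ?_)⟩
    rw [not_not.1 a.2, not_not.1 b.2]
  have hc := Fintype.card_subtype_compl (fun i => hH.eigenvalues i ≠ 0)
  rw [Matrix.rank] at hrank
  omega

open Matrix in
/-- If `q(G)` is the number of vertices, then every matrix in `S(G)` has nullity at most one. -/
theorem not_linearIndependent_ker_of_qGraph_eq_card {V : Type*} [Fintype V] [DecidableEq V]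
    {G : SimpleGraph V} (hG : qGraph G = Fintype.card V) {A : Matrix V V ℝ} (hA : SMat G A)
    {x y : V → ℝ} (hx : A *ᵥ x = 0) (hy : A *ᵥ y = 0) : ¬ LinearIndependent ℝ ![x, y] := by
  intro h
  have h1 := qMat_lt_card_of_linearIndependent_ker hA.1 hx hy h
  have h2 : qGraph G ≤ qMat A := Nat.sInf_le ⟨A, hA, rfl⟩
  omega

open Matrix in
/-- An eigenvector of a matrix in `S(P_n)` that vanishes at the first vertex is zero. -/
theorem eigenvector_eq_zero_of_pathG {V : Type*} [Fintype V] [DecidableEq V] {G : SimpleGraph V}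
    {n : ℕ} (e : G ≃g pathG n) {A : Matrix V V ℝ} (hA : SMat G A) {μ : ℝ} {z : V → ℝ}
    (hz : A *ᵥ z = μ • z) (h0 : ∀ hn : 0 < n, z (e.symm ⟨0, hn⟩) = 0) : z = 0 := by
  have key : ∀ m (hm : m < n), z (e.symm ⟨m, hm⟩) = 0 := by
    intro m
    induction m using Nat.strong_induction_on with
    | _ m ih =>
      intro hm
      obtain _ | k := m
      · exact h0 hm
      have hk : k < n := by omega
      have hrow := congrFun hz (e.symm ⟨k, hk⟩)
      rw [Pi.smul_apply, ih k (by omega) hk, smul_zero, mulVec, dotProduct,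
        Finset.sum_eq_single (e.symm ⟨k + 1, hm⟩)] at hrow
      · refine (mul_eq_zero.1 hrow).resolve_left ?_
        refine (hA.2 _ _ (by simp)).2 (e.symm.map_adj_iff.2 ?_)
        simp [pathG]
      · intro b _ hb
        obtain ⟨⟨j, hj⟩, rfl⟩ := e.symm.surjective b
        have hjk : j ≠ k + 1 := by rintro rfl; exact hb rfl
        rcases Nat.lt_or_ge j (k + 1) with h | h
        · rw [ih j h hj, mul_zero]
        · have hadj : ¬ G.Adj (e.symm ⟨k, hk⟩) (e.symm ⟨j, hj⟩) := by
            rw [e.symm.map_adj_iff]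
            simp [pathG]
            omega
          rw [not_not.1 (mt (hA.2 _ _ (by simp; omega)).1 hadj), zero_mul]
      · simp
  funext v
  simpa using key (e v) (e v).2

theorem SMat_adjMatrix {V : Type*} [Fintype V] [DecidableEq V] (G : SimpleGraph V)
    [DecidableRel G.Adj] : SMat G (G.adjMatrix ℝ) :=
  ⟨G.isSymm_adjMatrix, fun i j _ => by simp [SimpleGraph.adjMatrix_apply]⟩

open Matrix in
theorem qGraph_eq_card_of_iso_pathG {V : Type*} [Fintype V] [DecidableEq V] {G : SimpleGraph V}
    {n : ℕ} (e : G ≃g pathG n) : qGraph G = Fintype.card V := by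
  classical
  obtain ⟨A, hA, hq⟩ : qGraph G ∈ {k | ∃ A : Matrix V V ℝ, SMat G A ∧ qMat A = k} :=
    Nat.sInf_mem ⟨_, _, SMat_adjMatrix G, rfl⟩
  rw [← hq]
  refine qMat_eq_card_of_eigenvectors_dependent hA.1 fun μ x y hx hy hxy => ?_
  rw [LinearIndependent.pair_iff] at hxy
  have hx0 : x ≠ 0 := by
    rintro rfl
    simpa using hxy 1 0 (by simp)
  obtain rfl | hn := Nat.eq_zero_or_pos n
  · exact hx0 (eigenvector_eq_zero_of_pathG e hA hx (by simp))
  set v := e.symm ⟨0, hn⟩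
  have hxv : x v ≠ 0 := fun h => hx0 (eigenvector_eq_zero_of_pathG e hA hx fun _ => h)
  refine hxv (neg_eq_zero.1 (hxy (y v) (-x v) ?_).2)
  refine eigenvector_eq_zero_of_pathG e hA (μ := μ) ?_ fun _ => ?_
  · rw [mulVec_add, mulVec_smul, mulVec_smul, hx, hy]
    module
  · change y v * x v + -x v * y v = 0
    ring

/-- A connected acyclic graph with at most two neighbors at each vertex is a path. -/
theorem nonempty_iso_pathG_of_isAcyclic {V : Type*} [Fintype V] {G : SimpleGraph V}
    (hc : G.Preconnected) (ha : G.IsAcyclic)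
    (hd : ∀ v a b c, G.Adj v a → G.Adj v b → G.Adj v c → a = b ∨ a = c ∨ b = c) :
    Nonempty (G ≃g pathG (Fintype.card V)) := by
  classical
  cases isEmpty_or_nonempty V with
  | inl h =>
    have : IsEmpty (Fin (Fintype.card V)) := by
      rw [Fintype.card_eq_zero]; infer_instance
    exact ⟨⟨Equiv.equivOfIsEmpty _ _, fun {a} => h.elim a⟩⟩
  | inr h =>
    obtain ⟨u, v, p, hp, hmax⟩ :=
      SimpleGraph.Walk.exists_isPath_forall_isPath_length_le_length G
    have hnbr : ∀ i ≤ p.length, ∀ y, G.Adj (p.getVert i) y →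
        ∃ j ≤ p.length, p.getVert j = y ∧ (i + 1 = j ∨ j + 1 = i) := by
      intro i hi y hy
      obtain rfl | hi0 := Nat.eq_zero_or_pos i
      · rw [p.getVert_zero] at hy
        have hmem : y ∈ p.support := by
          by_contra hmem
          have := hmax _ _ (p.cons hy.symm) (hp.cons hmem)
          simp at this
        have := ha.eq_snd_of_adj_start hp hy hmem
        refine ⟨1, ?_, this.symm, by simp⟩
        by_contra hlen
        have hnil : p.length = 0 := by omega
        have hpy := p.getVert_of_length_le (i := 1) (by omega)
        have hpz := p.getVert_of_length_le (i := 0) (by omega)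
        rw [p.getVert_zero] at hpz
        apply hy.ne
        rw [this, SimpleGraph.Walk.snd, hpy, hpz]
      obtain rfl | hil := hi.eq_or_lt
      · rw [p.getVert_length] at hy
        have hmem : y ∈ p.support := by
          by_contra hmem
          have := hmax _ _ (p.concat hy) (hp.concat hmem hy)
          simp at this
        have := ha.eq_penultimate_of_adj_end hp hy hmem
        exact ⟨p.length - 1, by omega, this.symm, by omega⟩
      · have h1 := p.adj_getVert_succ hil
        have h2 := p.adj_getVert_succ (i := i - 1) (by omega)
        rw [Nat.sub_add_cancel hi0] at h2
        rcases hd _ _ _ _ h1 h2.symm hy with h | h | h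
        · have := hp.getVert_injOn (by simp; omega) (by simp; omega) h
          omega
        · exact ⟨i + 1, by omega, h, by omega⟩
        · exact ⟨i - 1, by omega, h, by omega⟩
    have hsurj : ∀ w, ∃ j ≤ p.length, p.getVert j = w := by
      intro w
      obtain ⟨q⟩ := hc u w
      have : ∀ a b, G.Walk a b → (∃ j ≤ p.length, p.getVert j = a) →
          ∃ j ≤ p.length, p.getVert j = b := by
        intro a b q
        induction q with
        | nil => exact id
        | cons hadj _ ih =>
          rintro ⟨j, hj, rfl⟩
          obtain ⟨k, hk, hkw, _⟩ := hnbr j hj _ hadj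
          exact ih ⟨k, hk, hkw⟩
      exact this u w q ⟨0, by omega, p.getVert_zero⟩
    have hbij : Function.Bijective fun i : Fin (p.length + 1) => p.getVert i := by
      refine ⟨fun i j hij => Fin.ext (hp.getVert_injOn ?_ ?_ hij), fun w => ?_⟩
      · simp; omega
      · simp; omega
      · obtain ⟨j, hj, hjw⟩ := hsurj w
        exact ⟨⟨j, by omega⟩, hjw⟩
    have hcard : p.length + 1 = Fintype.card V := by
      simpa using Fintype.card_of_bijective hbij
    rw [← hcard]
    refine ⟨SimpleGraph.Iso.symm ⟨Equiv.ofBijective _ hbij, ?_⟩⟩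
    intro i j
    change G.Adj (p.getVert i) (p.getVert j) ↔ _
    constructor
    · intro hadj
      obtain ⟨k, hk, hkj, hik⟩ := hnbr i (by omega) _ hadj
      have := hp.getVert_injOn (by simpa using hk) (by simp; omega) hkj
      subst this
      simp only [pathG, SimpleGraph.fromRel_adj]
      refine ⟨?_, hik⟩
      rintro rfl
      omega
    · simp only [pathG, SimpleGraph.fromRel_adj]
      rintro ⟨-, h | h⟩
      · rw [← h]
        exact p.adj_getVert_succ (by omega)
      · rw [← h]
        exact (p.adj_getVert_succ (by omega)).symm

open Matrix in
theorem preconnected_of_qGraph_eq_card {V : Type*} [Fintype V] [DecidableEq V]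
    {G : SimpleGraph V} (hG : qGraph G = Fintype.card V) : G.Preconnected := by
  classical
  intro u v
  by_contra huv
  have hS : SMat G (G.lapMatrix ℝ) := by
    refine ⟨G.isSymm_lapMatrix ℝ, fun i j hij => ?_⟩
    simp [SimpleGraph.lapMatrix, SimpleGraph.degMatrix, hij, SimpleGraph.adjMatrix_apply]
  have hker : ∀ w, G.lapMatrix ℝ *ᵥ (fun i => if G.Reachable w i then (1 : ℝ) else 0) = 0 := by
    intro w
    rw [SimpleGraph.lapMatrix_mulVec_eq_zero_iff_forall_adj]
    intro i j hij
    have : G.Reachable w i ↔ G.Reachable w j :=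
      ⟨fun h => h.trans hij.reachable, fun h => h.trans hij.symm.reachable⟩
    simp [this]
  refine not_linearIndependent_ker_of_qGraph_eq_card hG hS (hker u) (hker v) ?_
  rw [LinearIndependent.pair_iff]
  intro s t hst
  have h1 := congrFun hst u
  have h2 := congrFun hst v
  have hvu : ¬ G.Reachable v u := fun h => huv h.symm
  simp [huv, hvu] at h1 h2
  exact ⟨h1, h2⟩

/-- The real flows (circulations) on a graph `G`. -/
def flowSpace {V : Type*} [Fintype V] (G : SimpleGraph V) : Submodule ℝ (V → V → ℝ) where
  carrier := {φ | (∀ u v, φ u v = -φ v u) ∧ (∀ u v, ¬ G.Adj u v → φ u v = 0) ∧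
    ∀ u, ∑ v, φ u v = 0}
  zero_mem' := by simp
  add_mem' := by
    rintro a b ⟨a1, a2, a3⟩ ⟨b1, b2, b3⟩
    refine ⟨fun u v => ?_, fun u v h => ?_, fun u => ?_⟩
    · simp only [Pi.add_apply, a1 u v, b1 u v]; ring
    · simp [a2 u v h, b2 u v h]
    · simp [Finset.sum_add_distrib, a3, b3]
  smul_mem' := by
    rintro c a ⟨a1, a2, a3⟩
    refine ⟨fun u v => ?_, fun u v h => ?_, fun u => ?_⟩
    · simp only [Pi.smul_apply, a1 u v, smul_neg]
    · simp [a2 u v h]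
    · simp [← Finset.mul_sum, a3]

/-- The unit antisymmetric function along an ordered pair of vertices. -/
def unitArc {V : Type*} [DecidableEq V] (u v : V) : V → V → ℝ := fun a b =>
  (if a = u ∧ b = v then 1 else 0) - (if a = v ∧ b = u then 1 else 0)

theorem unitArc_antisymm {V : Type*} [DecidableEq V] (u v a b : V) :
    unitArc u v a b = -unitArc u v b a := by
  simp only [unitArc, neg_sub, and_comm]

theorem sum_unitArc {V : Type*} [Fintype V] [DecidableEq V] (u v a : V) :
    ∑ b, unitArc u v a b = (if a = u then 1 else 0) - (if a = v then 1 else 0) := by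
  simp [unitArc, Finset.sum_sub_distrib, ite_and]

/-- A unit flow from `u` to `v` exists when `v` is reachable from `u`. -/
theorem exists_unit_flow {V : Type*} [Fintype V] [DecidableEq V] {H : SimpleGraph V} {u v : V}
    (h : H.Reachable u v) : ∃ ψ : V → V → ℝ, (∀ a b, ψ a b = -ψ b a) ∧
      (∀ a b, ¬ H.Adj a b → ψ a b = 0) ∧
      ∀ a, ∑ b, ψ a b = (if a = u then 1 else 0) - (if a = v then 1 else 0) := by
  obtain ⟨p⟩ := h
  induction p with
  | nil => exact ⟨0, by simp, by simp, by simp⟩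
  | @cons u w v hadj _ ih =>
    obtain ⟨ψ, h1, h2, h3⟩ := ih
    refine ⟨unitArc u w + ψ, fun a b => ?_, fun a b hab => ?_, fun a => ?_⟩
    · simp only [Pi.add_apply, h1 a b, unitArc_antisymm u w a b]; ring
    · have e1 : ¬ (a = u ∧ b = w) := by rintro ⟨rfl, rfl⟩; exact hab hadj
      have e2 : ¬ (a = w ∧ b = u) := by rintro ⟨rfl, rfl⟩; exact hab hadj.symm
      simp [unitArc, e1, e2, h2 a b hab]
    · simp [Finset.sum_add_distrib, sum_unitArc, h3]

/-- An edge closes up a path avoiding it to a flow. -/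
theorem exists_flow_of_adj_of_reachable {V : Type*} [Fintype V] [DecidableEq V]
    {G H : SimpleGraph V} (hHG : H ≤ G) {u v : V} (hG : G.Adj u v) (hH : ¬ H.Adj u v)
    (h : H.Reachable u v) : ∃ ψ ∈ flowSpace G, ψ u v ≠ 0 ∧ ∃ a b, H.Adj a b ∧ ψ a b ≠ 0 := by
  obtain ⟨ψ, h1, h2, h3⟩ := exists_unit_flow h
  have hne := hG.ne
  refine ⟨unitArc u v - ψ, ⟨fun a b => ?_, fun a b hab => ?_, fun a => ?_⟩, ?_, ?_⟩
  · simp only [Pi.sub_apply, h1 a b, unitArc_antisymm u v a b]; ring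
  · have e1 : ¬ (a = u ∧ b = v) := by rintro ⟨rfl, rfl⟩; exact hab hG
    have e2 : ¬ (a = v ∧ b = u) := by rintro ⟨rfl, rfl⟩; exact hab hG.symm
    simp [unitArc, e1, e2, h2 a b fun h => hab (hHG h)]
  · simp [Finset.sum_sub_distrib, sum_unitArc, h3]
  · simp [unitArc, h2 u v hH, hne]
  · have hsum : ∑ b, ψ u b ≠ 0 := by simp [h3, hne]
    obtain ⟨b, -, hb⟩ := Finset.exists_ne_zero_of_sum_ne_zero hsum
    have hub : H.Adj u b := by
      by_contra hc
      exact hb (h2 u b hc)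
    refine ⟨u, b, hub, ?_⟩
    have e1 : b ≠ v := by rintro rfl; exact hH hub
    simpa [unitArc, e1, hne] using hb

/-- There is a flow whose support contains the support of every other flow. -/
theorem exists_flow_maximal_support {V : Type*} [Fintype V] (G : SimpleGraph V) :
    ∃ φ ∈ flowSpace G, ∀ ψ ∈ flowSpace G, ∀ u v, ψ u v ≠ 0 → φ u v ≠ 0 := by
  obtain ⟨φ, hφ, h⟩ := Module.Dual.exists_forall_mem_ne_zero_of_forall_exists (flowSpace G)
    (ι := {p : V × V // ∃ ψ ∈ flowSpace G, ψ p.1 p.2 ≠ 0})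
    (fun p => (LinearMap.proj (φ := fun _ : V => ℝ) p.1.2).comp
      (LinearMap.proj (R := ℝ) (φ := fun _ : V => V → ℝ) p.1.1)) (fun p => p.2)
  exact ⟨φ, hφ, fun ψ hψ u v huv => h ⟨(u, v), ψ, hψ, huv⟩⟩

open Matrix in
theorem flow_eq_zero_of_qGraph_eq_card {V : Type*} [Fintype V] [DecidableEq V]
    {G : SimpleGraph V} (hG : qGraph G = Fintype.card V) {ψ : V → V → ℝ}
    (hψ : ψ ∈ flowSpace G) (u v : V) : ψ u v = 0 := by
  classical
  by_contra huv
  obtain ⟨φ, ⟨h1, h2, h3⟩, hmax⟩ := exists_flow_maximal_support G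
  have hφuv := hmax ψ hψ u v huv
  have hadj_of : ∀ a b, φ a b ≠ 0 → G.Adj a b := fun a b h => by
    by_contra hc
    exact h (h2 a b hc)
  let H : SimpleGraph V :=
    { Adj a b := G.Adj a b ∧ φ a b = 0
      symm := ⟨fun a b h => ⟨h.1.symm, by rw [h1, h.2, neg_zero]⟩⟩
      loopless := ⟨fun a h => G.irrefl h.1⟩ }
  have hreach : ∀ a b, φ a b ≠ 0 → ¬ H.Reachable a b := by
    intro a b hab hr
    obtain ⟨χ, hχ, -, c, d, hcd, hne⟩ := exists_flow_of_adj_of_reachable (G := G) (H := H)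
      (fun _ _ h => h.1) (hadj_of a b hab) (fun h => hab h.2) hr
    exact hmax χ hχ c d hne hcd.2
  let y : V → ℝ := fun a => (Fintype.equivFin H.ConnectedComponent (H.connectedComponentMk a)).val
  have hy : ∀ a b, y a = y b ↔ H.Reachable a b := by
    intro a b
    simp only [y, Nat.cast_inj, Fin.val_inj, EmbeddingLike.apply_eq_iff_eq,
      SimpleGraph.ConnectedComponent.eq]
  let w : V → V → ℝ := fun a b =>
    if G.Adj a b then (if y a = y b then 1 else φ a b / (y b - y a)) else 0
  have hw_symm : ∀ a b, w a b = w b a := by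
    intro a b
    simp only [w, G.adj_comm a b, eq_comm (a := y a)]
    split_ifs with e1 e2
    · rfl
    · rw [h1 a b, ← neg_sub (y a) (y b), neg_div_neg_eq]
    · rfl
  have hw_self : ∀ a, w a a = 0 := fun a => by simp [w]
  let A : Matrix V V ℝ := Matrix.of w - Matrix.diagonal fun a => ∑ b, w a b
  have hA : SMat G A := by
    refine ⟨?_, fun a b hab => ?_⟩
    · ext a b
      by_cases hab : a = b
      · simp [hab]
      · simp [A, hab, Ne.symm hab, hw_symm a b]
    · simp only [A, Matrix.sub_apply, Matrix.of_apply, Matrix.diagonal_apply_ne _ hab, sub_zero, w]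
      by_cases hadj : G.Adj a b
      · simp only [hadj, if_true, iff_true]
        split_ifs with e
        · exact one_ne_zero
        · refine div_ne_zero (fun h0 => e ?_) (sub_ne_zero.2 (Ne.symm e))
          rw [hy]
          exact SimpleGraph.Adj.reachable (G := H) ⟨hadj, h0⟩
      · simp [hadj]
  have hAv : ∀ x : V → ℝ, ∀ a, (A *ᵥ x) a = ∑ b, w a b * (x b - x a) := by
    intro x a
    simp only [A, sub_mulVec, Pi.sub_apply, mulVec_diagonal, mul_sub, Finset.sum_sub_distrib,
      Finset.sum_mul]
    rfl
  have hone : A *ᵥ (fun _ => (1 : ℝ)) = 0 := by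
    funext a
    simp [hAv]
  have hAy : A *ᵥ y = 0 := by
    funext a
    rw [hAv, Pi.zero_apply, ← h3 a]
    refine Finset.sum_congr rfl fun b _ => ?_
    by_cases hab : y a = y b
    · have : φ a b = 0 := by
        by_contra hc
        exact hreach a b hc ((hy a b).1 hab)
      rw [hab, sub_self, mul_zero, this]
    · by_cases hadj : G.Adj a b
      · simp only [w, hadj, hab, if_true, if_false]
        exact div_mul_cancel₀ _ (sub_ne_zero.2 (Ne.symm hab))
      · simp [w, hadj, h2 a b hadj]
  refine not_linearIndependent_ker_of_qGraph_eq_card hG hA hone hAy ?_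
  rw [LinearIndependent.pair_iff]
  intro s t hst
  have e1 := congrFun hst u
  have e2 := congrFun hst v
  simp only [Pi.add_apply, Pi.smul_apply, smul_eq_mul, mul_one, Pi.zero_apply] at e1 e2
  have hyuv : y u - y v ≠ 0 := sub_ne_zero.2 fun h => hreach u v hφuv ((hy u v).1 h)
  have ht : t = 0 := (mul_eq_zero.1 (show t * (y u - y v) = 0 by linear_combination e1 - e2)
    ).resolve_right hyuv
  subst ht
  simpa using e1

theorem isAcyclic_of_qGraph_eq_card {V : Type*} [Fintype V] [DecidableEq V]
    {G : SimpleGraph V} (hG : qGraph G = Fintype.card V) : G.IsAcyclic := by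
  rw [SimpleGraph.isAcyclic_iff_forall_adj_isBridge]
  intro u v huv
  rw [SimpleGraph.isBridge_iff]
  intro hr
  obtain ⟨ψ, hψ, hne, -⟩ := exists_flow_of_adj_of_reachable (G.deleteEdges_le _) huv (by simp) hr
  exact hne (flow_eq_zero_of_qGraph_eq_card hG hψ u v)

open Matrix in
theorem neighbors_le_two_of_qGraph_eq_card {V : Type*} [Fintype V] [DecidableEq V]
    {G : SimpleGraph V} (hG : qGraph G = Fintype.card V) (v a b c : V) (ha : G.Adj v a)
    (hb : G.Adj v b) (hc : G.Adj v c) : a = b ∨ a = c ∨ b = c := by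
  classical
  by_contra! hne
  obtain ⟨hab, hac, hbc⟩ := hne
  let H : SimpleGraph V :=
    { Adj i j := G.Adj i j ∧ i ≠ v ∧ j ≠ v
      symm := ⟨fun i j h => ⟨h.1.symm, h.2.2, h.2.1⟩⟩
      loopless := ⟨fun i h => G.irrefl h.1⟩ }
  have hsep : ∀ i j, G.Adj v i → G.Adj v j → H.Reachable i j → i = j := by
    intro i j hi hj hr
    by_contra hij
    have hbr := SimpleGraph.isAcyclic_iff_forall_adj_isBridge.1 (isAcyclic_of_qGraph_eq_card hG) hi
    rw [SimpleGraph.isBridge_iff] at hbr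
    refine hbr (SimpleGraph.Reachable.trans (v := j) (SimpleGraph.Adj.reachable ?_)
      (hr.symm.mono ?_))
    · rw [SimpleGraph.deleteEdges_adj]
      refine ⟨hj, ?_⟩
      simp [hi.ne, Ne.symm hij]
    · intro k l hkl
      rw [SimpleGraph.deleteEdges_adj]
      refine ⟨hkl.1, ?_⟩
      simp [hkl.2.1, hkl.2.2]
  let A : Matrix V V ℝ := H.lapMatrix ℝ + G.adjMatrix ℝ - H.adjMatrix ℝ
  have hA : SMat G A := by
    refine ⟨((H.isSymm_lapMatrix ℝ).add G.isSymm_adjMatrix).sub H.isSymm_adjMatrix, fun i j hij => ?_⟩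
    by_cases hG' : G.Adj i j <;> by_cases hH' : H.Adj i j
    · simp [A, SimpleGraph.lapMatrix, SimpleGraph.degMatrix, hij, SimpleGraph.adjMatrix_apply, hG',
        hH']
    · simp [A, SimpleGraph.lapMatrix, SimpleGraph.degMatrix, hij, SimpleGraph.adjMatrix_apply, hG',
        hH']
    · exact absurd hH'.1 hG'
    · simp [A, SimpleGraph.lapMatrix, SimpleGraph.degMatrix, hij, SimpleGraph.adjMatrix_apply, hG',
        hH']
  let f : V → V → ℝ := fun k i => if H.Reachable k i then 1 else 0
  have hv : ∀ k, k ≠ v → ¬ H.Reachable k v := by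
    rintro k hk ⟨p⟩
    cases p.reverse with
    | nil => exact hk rfl
    | cons h _ => exact h.2.1 rfl
  have hfv : ∀ k, G.Adj v k → f k v = 0 := fun k hk => if_neg (hv k hk.ne')
  have hsum : ∀ k, G.Adj v k → ∑ i ∈ G.neighborFinset v, f k i = 1 := by
    intro k hk
    rw [Finset.sum_eq_single k]
    · simp [f]
    · intro i hi hik
      rw [SimpleGraph.mem_neighborFinset] at hi
      exact if_neg fun hr => hik (hsep k i hk hi hr).symm
    · simp [hk]
  have hker : ∀ k l, G.Adj v k → G.Adj v l → A *ᵥ (f k - f l) = 0 := by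
    intro k l hk hl
    have hlap : H.lapMatrix ℝ *ᵥ (f k - f l) = 0 := by
      have : ∀ m, H.lapMatrix ℝ *ᵥ f m = 0 := by
        intro m
        rw [SimpleGraph.lapMatrix_mulVec_eq_zero_iff_forall_adj]
        intro i j hij
        have : H.Reachable m i ↔ H.Reachable m j :=
          ⟨fun h => h.trans hij.reachable, fun h => h.trans hij.symm.reachable⟩
        simp [f, this]
      rw [mulVec_sub, this, this, sub_zero]
    rw [sub_mulVec, add_mulVec, hlap, zero_add, sub_eq_zero]
    funext i
    rw [SimpleGraph.adjMatrix_mulVec_apply, SimpleGraph.adjMatrix_mulVec_apply]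
    by_cases hiv : i = v
    · subst hiv
      have : H.neighborFinset i = ∅ := by
        ext j
        simp [H]
      rw [this, Finset.sum_empty]
      simp [Finset.sum_sub_distrib, hsum k hk, hsum l hl]
    · symm
      apply Finset.sum_subset
      · intro j hj
        rw [SimpleGraph.mem_neighborFinset] at hj ⊢
        exact hj.1
      · intro j hj hj'
        rw [SimpleGraph.mem_neighborFinset] at hj hj'
        have : j = v := by
          by_contra hjv
          exact hj' ⟨hj, hiv, hjv⟩
        rw [this, Pi.sub_apply, hfv k hk, hfv l hl, sub_zero]
  refine not_linearIndependent_ker_of_qGraph_eq_card hG hA (hker b a hb ha) (hker c a hc ha) ?_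
  rw [LinearIndependent.pair_iff]
  intro s t hst
  have hval : ∀ k i, G.Adj v k → G.Adj v i → k ≠ i → f k i = 0 := fun k i hk hi hki =>
    if_neg fun hr => hki (hsep k i hk hi hr)
  have hself : ∀ k, f k k = 1 := fun k => by simp [f]
  have h1 := congrFun hst b
  have h2 := congrFun hst c
  simp only [Pi.add_apply, Pi.smul_apply, Pi.sub_apply, Pi.zero_apply, hself,
    hval a b ha hb hab, hval c b hc hb (Ne.symm hbc), hval b c hb hc hbc, hval a c ha hc hac,
    smul_eq_mul, sub_zero, mul_zero, mul_one, add_zero, zero_add] at h1 h2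
  exact ⟨h1, h2⟩

/-- `q(G) = |V(G)|` if and only if `G` is a path. -/
theorem stmt_4 {V : Type*} [Fintype V] [DecidableEq V] (G : SimpleGraph V) :
    qGraph G = Fintype.card V ↔ Nonempty (G ≃g pathG (Fintype.card V)) := by
  refine ⟨fun h => ?_, fun ⟨e⟩ => qGraph_eq_card_of_iso_pathG e⟩
  exact nonempty_iso_pathG_of_isAcyclic (preconnected_of_qGraph_eq_card h)
    (isAcyclic_of_qGraph_eq_card h) (neighbors_le_two_of_qGraph_eq_card h)
end

section
/- Let G be a connected finite simple graph and let u, v be vertices of G at distance d such that there is exactly one path of length d from u to v in G. Then q(G) ≥ d + 1. -/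
section

open Polynomial

variable {V : Type*} [Fintype V] [DecidableEq V] {G : SimpleGraph V} {A : Matrix V V ℝ}

theorem SMat.pow_apply_eq_zero (hA : SMat G A) (hconn : G.Connected) {k : ℕ} {u v : V}
    (h : k < G.dist u v) : (A ^ k) u v = 0 := by
  induction k generalizing u with
  | zero =>
    have huv : u ≠ v := by
      rintro rfl
      simp at h
    simp [huv]
  | succ k ih =>
    rw [pow_succ', Matrix.mul_apply]
    refine Finset.sum_eq_zero fun w _ => ?_
    by_cases hw : A u w = 0
    · simp [hw]
    rw [ih, mul_zero]
    by_cases huw : u = w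
    · subst huw
      omega
    · have hadj := (hA.2 u w huw).1 hw
      have htri := hconn.dist_triangle (u := u) (v := w) (w := v)
      rw [SimpleGraph.dist_eq_one_iff_adj.2 hadj] at htri
      omega

theorem SMat.pow_apply_ne_zero (hA : SMat G A) (hconn : G.Connected) {d : ℕ} {u v : V}
    (hd : G.dist u v = d)
    (huniq : ∀ p q : G.Walk u v, p.length = d → q.length = d → p = q) :
    (A ^ d) u v ≠ 0 := by
  induction d generalizing u with
  | zero =>
    obtain rfl := hconn.dist_eq_zero_iff.1 hd
    simp
  | succ d ih =>
    obtain ⟨p, hp⟩ := hconn.exists_walk_length_eq_dist u v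
    rw [hd] at hp
    cases p with
    | nil => simp at hp
    | @cons _ w _ hadj p =>
      have hp' : p.length = d := by simpa using hp
      have hwle : G.dist w v ≤ d := hp' ▸ SimpleGraph.dist_le p
      have htri := hconn.dist_triangle (u := u) (v := w) (w := v)
      rw [SimpleGraph.dist_eq_one_iff_adj.2 hadj] at htri
      have hw : (A ^ d) w v ≠ 0 := by
        refine ih (by omega) fun q r hq hr => ?_
        have := huniq (.cons hadj q) (.cons hadj r) (by simp [hq]) (by simp [hr])
        simpa using this
      rw [pow_succ', Matrix.mul_apply, Finset.sum_eq_single w]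
      · exact mul_ne_zero ((hA.2 u w hadj.ne).2 hadj) hw
      · intro x _ hxw
        by_contra hne
        have hx := left_ne_zero_of_mul hne
        have hxd : G.dist x v ≤ d :=
          not_lt.1 fun h => right_ne_zero_of_mul hne (hA.pow_apply_eq_zero hconn h)
        have hux : u ≠ x := by
          rintro rfl
          omega
        have hadjx := (hA.2 u x hux).1 hx
        obtain ⟨r, hr⟩ := hconn.exists_walk_length_eq_dist x v
        have htrix := hconn.dist_triangle (u := u) (v := x) (w := v)
        rw [SimpleGraph.dist_eq_one_iff_adj.2 hadjx] at htrix
        have heq := huniq (.cons hadjx r) (.cons hadj p) (by simp; omega) (by simp [hp'])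
        have := congrArg SimpleGraph.Walk.snd heq
        exact hxw (by simpa using this)
      · simp

theorem IsSelfAdjoint.matrix_aeval_eq_zero_of_eval_spectrum (hA : IsSelfAdjoint A) {p : ℝ[X]}
    (hp : ∀ x ∈ spectrum ℝ A, p.eval x = 0) : aeval A p = 0 := by
  rw [← cfc_polynomial p A hA, cfc_congr (g := fun _ => 0) hp, cfc_const_zero]

theorem SMat.lt_qMat (hA : SMat G A) (hconn : G.Connected) {d : ℕ} {u v : V}
    (hd : G.dist u v = d)
    (huniq : ∀ p q : G.Walk u v, p.length = d → q.length = d → p = q) :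
    d < qMat A := by
  by_contra! hle
  have hfin : (spectrum ℝ A).Finite := Matrix.finite_spectrum A
  rw [qMat, Set.ncard_eq_toFinset_card _ hfin] at hle
  set s := hfin.toFinset
  set p : ℝ[X] := X ^ (d - s.card) * ∏ x ∈ s, (X - C x)
  have hmonic : p.Monic := (monic_X_pow _).mul (monic_prod_X_sub_C _ _)
  have hdeg : p.natDegree = d := by
    rw [(monic_X_pow _).natDegree_mul (monic_prod_X_sub_C _ _), natDegree_X_pow,
      natDegree_finsetProd_X_sub_C_eq_card]
    omega
  have hherm : IsSelfAdjoint A := by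
    simpa [IsSelfAdjoint, Matrix.IsSymm, Matrix.star_eq_conjTranspose,
      Matrix.conjTranspose_eq_transpose_of_trivial] using hA.1
  have hzero : aeval A p = 0 := hherm.matrix_aeval_eq_zero_of_eval_spectrum fun x hx => by
    have hxs : x ∈ s := hfin.mem_toFinset.2 hx
    rw [eval_mul, eval_prod, Finset.prod_eq_zero hxs (by simp), mul_zero]
  refine hA.pow_apply_ne_zero hconn hd huniq ?_
  have hentry := congrFun (congrFun hzero u) v
  rw [aeval_eq_sum_range, hdeg, Finset.sum_range_succ, Matrix.add_apply, Matrix.sum_apply,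
    Finset.sum_eq_zero] at hentry
  · have hcoeff : p.coeff d = 1 := hdeg ▸ hmonic.coeff_natDegree
    simpa [hcoeff] using hentry
  · intro k hk
    rw [Matrix.smul_apply, hA.pow_apply_eq_zero hconn (hd ▸ Finset.mem_range.1 hk), smul_zero]

theorem exists_sMat (G : SimpleGraph V) : ∃ A : Matrix V V ℝ, SMat G A := by
  classical
  exact ⟨G.adjMatrix ℝ, G.isSymm_adjMatrix, fun i j _ => by simp [SimpleGraph.adjMatrix_apply]⟩

end

/-- If `u`, `v` are vertices of a connected graph `G` at distance `d` and the path of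
length `d` from `u` to `v` is unique, then `q(G) ≥ d + 1`. -/
theorem stmt_5 {V : Type*} [Fintype V] [DecidableEq V] (G : SimpleGraph V)
    (hconn : G.Connected) (u v : V) (d : ℕ) (hd : G.dist u v = d)
    (huniq : ∃! p : G.Path u v, (p : G.Walk u v).length = d) :
    d + 1 ≤ qGraph G := by
  obtain ⟨A₀, hA₀⟩ := exists_sMat G
  refine le_csInf ⟨_, A₀, hA₀, rfl⟩ ?_
  rintro _ ⟨A, hA, rfl⟩
  refine hA.lt_qMat hconn hd fun p q hp hq => ?_
  have heq := huniq.unique (y₁ := ⟨p, p.isPath_of_length_eq_dist (hp.trans hd.symm)⟩)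
    (y₂ := ⟨q, q.isPath_of_length_eq_dist (hq.trans hd.symm)⟩) hp hq
  exact congrArg Subtype.val heq
end

section
/- Let G be a connected finite simple graph. If A ∈ S(G) has all entries nonnegative, then the number of distinct eigenvalues of A satisfies q(A) ≥ diam(G) + 1. -/
open Polynomial in
/-- A Hermitian matrix is annihilated by the product of `X - μ` over its distinct eigenvalues. -/
theorem Matrix.IsHermitian.aeval_prod_X_sub_C_spectrum {V : Type*} [Fintype V] [DecidableEq V]
    {A : Matrix V V ℝ} (hA : A.IsHermitian) (hfin : (spectrum ℝ A).Finite) :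
    aeval A (∏ μ ∈ hfin.toFinset, (X - C μ)) = 0 := by
  have hs : IsSelfAdjoint A := hA
  rw [← cfc_polynomial _ A hs, ← cfc_const_zero ℝ A]
  refine cfc_congr fun x hx => ?_
  rw [eval_prod]
  exact Finset.prod_eq_zero (hfin.mem_toFinset.2 hx) (by simp)

/-- A nonzero entry of `A ^ k` forces the graph distance to be at most `k`. -/
theorem SMat.dist_le_of_pow_apply_ne_zero {V : Type*} [Fintype V] [DecidableEq V]
    {G : SimpleGraph V} (hconn : G.Connected) {A : Matrix V V ℝ} (hA : SMat G A) {u v : V}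
    {k : ℕ} (h : (A ^ k) u v ≠ 0) : G.dist u v ≤ k := by
  induction k generalizing v with
  | zero =>
    have huv : u = v := by
      by_contra hne
      exact h (by simp [Matrix.one_apply_ne hne])
    simp [huv]
  | succ k ih =>
    rw [pow_succ, Matrix.mul_apply] at h
    obtain ⟨w, -, hw⟩ := Finset.exists_ne_zero_of_sum_ne_zero h
    have h1 := ih (left_ne_zero_of_mul hw)
    rcases eq_or_ne w v with rfl | hwv
    · omega
    · have hadj := (hA.2 w v hwv).1 (right_ne_zero_of_mul hw)
      have h2 := hconn.dist_triangle (u := u) (v := w) (w := v)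
      have h3 := SimpleGraph.dist_eq_one_iff_adj.2 hadj
      omega

/-- Powers of an entrywise nonnegative matrix are entrywise nonnegative. -/
theorem Matrix.pow_apply_nonneg_of_nonneg {V : Type*} [Fintype V] [DecidableEq V]
    {A : Matrix V V ℝ} (hpos : ∀ i j, 0 ≤ A i j) (k : ℕ) (i j : V) : 0 ≤ (A ^ k) i j := by
  induction k generalizing i j with
  | zero =>
    rw [pow_zero, Matrix.one_apply]
    split_ifs <;> norm_num
  | succ k ih =>
    rw [pow_succ, Matrix.mul_apply]
    exact Finset.sum_nonneg fun w _ => mul_nonneg (ih i w) (hpos w j)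

/-- For a nonnegative matrix in `S(G)`, a walk of length `k` gives a positive entry of `A ^ k`. -/
theorem SMat.pow_length_apply_pos {V : Type*} [Fintype V] [DecidableEq V]
    {G : SimpleGraph V} {A : Matrix V V ℝ} (hA : SMat G A) (hpos : ∀ i j, 0 ≤ A i j)
    {u v : V} (p : G.Walk u v) : 0 < (A ^ p.length) u v := by
  induction p with
  | nil => simp
  | @cons u w v hadj p ih =>
    rw [SimpleGraph.Walk.length_cons, pow_succ', Matrix.mul_apply]
    refine Finset.sum_pos' (fun x _ => mul_nonneg (hpos u x)
      (Matrix.pow_apply_nonneg_of_nonneg hpos _ x v)) ⟨w, Finset.mem_univ w, mul_pos ?_ ih⟩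
    exact (hpos u w).lt_of_ne' ((hA.2 u w hadj.ne).2 hadj)

open Polynomial in
/-- If `G` is connected and `A ∈ S(G)` is entrywise nonnegative,
then `q(A) ≥ diam(G) + 1`. -/
theorem stmt_6 {V : Type*} [Fintype V] [DecidableEq V] (G : SimpleGraph V)
    (hconn : G.Connected) (A : Matrix V V ℝ) (hA : SMat G A)
    (hpos : ∀ i j : V, 0 ≤ A i j) :
    G.diam + 1 ≤ qMat A := by
  have hherm : A.IsHermitian := by
    rw [Matrix.IsHermitian, Matrix.conjTranspose_eq_transpose_of_trivial]
    exact hA.1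
  have hfin : (spectrum ℝ A).Finite := Matrix.finite_real_spectrum
  by_contra! hlt
  have hq : qMat A = hfin.toFinset.card := Set.ncard_eq_toFinset_card _ hfin
  have := hconn.nonempty
  obtain ⟨u, v, huv⟩ := G.exists_dist_eq_diam
  obtain ⟨p, hp⟩ := hconn.exists_walk_length_eq_dist u v
  have hPos : 0 < (A ^ G.diam) u v := by
    rw [← huv, ← hp]
    exact hA.pow_length_apply_pos hpos p
  let P : ℝ[X] := (∏ μ ∈ hfin.toFinset, (X - C μ)) * X ^ (G.diam - qMat A)
  have hmonic₀ : (∏ μ ∈ hfin.toFinset, (X - C μ)).Monic :=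
    monic_prod_of_monic _ _ fun μ _ => monic_X_sub_C μ
  have hmonic : P.Monic := hmonic₀.mul (monic_X_pow _)
  have hdeg : P.natDegree = G.diam := by
    rw [hmonic₀.natDegree_mul (monic_X_pow _), natDegree_X_pow,
      natDegree_prod_of_monic _ _ fun μ _ => monic_X_sub_C μ]
    simp only [natDegree_X_sub_C, Finset.sum_const, smul_eq_mul, mul_one]
    omega
  have hzero : aeval A P = 0 := by
    rw [map_mul, hherm.aeval_prod_X_sub_C_spectrum hfin, zero_mul]
  have hentry : (aeval A P) u v = (A ^ G.diam) u v := by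
    rw [aeval_eq_sum_range, hdeg, Finset.sum_range_succ, ← hdeg, hmonic.coeff_natDegree, one_smul,
      hdeg, Matrix.add_apply, Matrix.sum_apply, Finset.sum_eq_zero, zero_add]
    intro k hk
    have hk0 : (A ^ k) u v = 0 := by
      by_contra h
      have := hA.dist_le_of_pow_apply_ne_zero hconn h
      have := Finset.mem_range.1 hk
      omega
    rw [Matrix.smul_apply, hk0, smul_zero]
  rw [hzero, Matrix.zero_apply] at hentry
  exact hPos.ne hentry
end

section
/- For any pair of integers k, n with 2 ≤ k ≤ n, let G(n,k) be the graph on vertices v_1,...,v_n in which the vertices v_1,...,v_{n−k+2} form a clique and the vertices v_{n−k+2}, v_{n−k+3}, ..., v_{n−1}, v_n form an induced path (so a path of length k−2 is attached to one vertex of the clique). Then q(G(n,k)) = k. -/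
/-- The graph `G(n,k)` on vertices `0, ..., n-1` (corresponding to `v_1, ..., v_n`):
the vertices `0, ..., n-k+1` form a clique and the vertices `n-k+1, n-k+2, ..., n-1`
form an induced path of length `k-2` attached to the clique. -/
def Gnk (n k : ℕ) : SimpleGraph (Fin n) :=
  SimpleGraph.fromRel (fun i j =>
    (i.val ≤ n - k + 1 ∧ j.val ≤ n - k + 1) ∨
    (i.val + 1 = j.val ∧ n - k + 1 ≤ i.val))

open Polynomial in
/-- A polynomial vanishing on the spectrum of a real symmetric matrix annihilates the matrix. -/
theorem aeval_eq_zero_of_forall_mem_spectrum {V : Type*} [Fintype V] [DecidableEq V]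
    {A : Matrix V V ℝ} (hA : A.IsSymm) (P : ℝ[X]) (hP : ∀ x ∈ spectrum ℝ A, P.eval x = 0) :
    aeval A P = 0 := by
  have hsa : IsSelfAdjoint A := by
    rw [← Matrix.isHermitian_iff_isSelfAdjoint]
    simpa [Matrix.IsHermitian, Matrix.conjTranspose_eq_transpose_of_trivial] using hA.eq
  rw [← cfc_polynomial P A hsa, cfc_congr (g := fun _ => 0) hP, cfc_const_zero]

open Polynomial in
/-- A real symmetric matrix is annihilated by a monic polynomial of degree `qMat A`. -/
theorem exists_monic_natDegree_eq_qMat {V : Type*} [Fintype V] [DecidableEq V]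
    {A : Matrix V V ℝ} (hA : A.IsSymm) :
    ∃ P : ℝ[X], P.Monic ∧ P.natDegree = qMat A ∧ aeval A P = 0 := by
  have hfin : (spectrum ℝ A).Finite := Matrix.finite_spectrum A
  refine ⟨∏ x ∈ hfin.toFinset, (X - C x), monic_prod_X_sub_C _ _, ?_, ?_⟩
  · rw [natDegree_finsetProd_X_sub_C_eq_card, qMat, Set.ncard_eq_toFinset_card _ hfin]
  · refine aeval_eq_zero_of_forall_mem_spectrum hA _ fun x hx => ?_
    rw [eval_prod]
    exact Finset.prod_eq_zero (hfin.mem_toFinset.2 hx) (by simp)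

/-- A real symmetric matrix has at most `rank + 1` distinct eigenvalues. -/
theorem qMat_le_rank_add_one {V : Type*} [Fintype V] [DecidableEq V]
    {A : Matrix V V ℝ} (hA : A.IsSymm) : qMat A ≤ A.rank + 1 := by
  have hH : A.IsHermitian := by
    simpa [Matrix.IsHermitian, Matrix.conjTranspose_eq_transpose_of_trivial] using hA.eq
  have hsub : spectrum ℝ A ⊆
      insert 0 (Set.range fun i : {i // hH.eigenvalues i ≠ 0} => hH.eigenvalues i) := by
    rw [hH.spectrum_real_eq_range_eigenvalues]
    rintro _ ⟨i, rfl⟩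
    by_cases h : hH.eigenvalues i = 0
    · exact Or.inl h
    · exact Or.inr ⟨⟨i, h⟩, rfl⟩
  rw [hH.rank_eq_card_non_zero_eigs, qMat]
  refine (Set.ncard_le_ncard hsub (Set.toFinite _)).trans ((Set.ncard_insert_le _ _).trans ?_)
  rw [← Set.image_univ, ← Nat.card_eq_fintype_card, ← Set.ncard_univ]
  exact Nat.add_le_add_right (Set.ncard_image_le (Set.toFinite _)) 1

theorem Gnk_adj {n k : ℕ} {i j : Fin n} :
    (Gnk n k).Adj i j ↔ i ≠ j ∧
      ((i.val ≤ n - k + 1 ∧ j.val ≤ n - k + 1) ∨ (i.val + 1 = j.val ∧ n - k + 1 ≤ i.val) ∨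
        (j.val + 1 = i.val ∧ n - k + 1 ≤ j.val)) := by
  rw [Gnk, SimpleGraph.fromRel_adj]
  tauto

section LowerBound

variable {n k : ℕ} {A : Matrix (Fin n) (Fin n) ℝ}

/-- Walks of length `d` in `Gnk n k` ending in the last vertex start among the last `d + 1`
vertices, as long as they are too short to leave the path. -/
theorem pow_apply_last_eq_zero (hkn : k ≤ n) (hA : SMat (Gnk n k) A) {l : Fin n}
    (hl : l.val + 1 = n) (d : ℕ) (hd : d + 1 < k) (i : Fin n) (hi : i.val + d + 1 < n) :
    (A ^ d) i l = 0 := by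
  induction d generalizing i with
  | zero =>
    rw [pow_zero, Matrix.one_apply_ne]
    rintro rfl
    omega
  | succ d ih =>
    rw [pow_succ', Matrix.mul_apply]
    refine Finset.sum_eq_zero fun j _ => ?_
    by_cases hj : j.val + d + 1 < n
    · rw [ih (by omega) j hj, mul_zero]
    · have hij : i ≠ j := by rintro rfl; omega
      have : ¬ (Gnk n k).Adj i j := by rw [Gnk_adj]; omega
      rw [← hA.2 i j hij, not_not] at this
      rw [this, zero_mul]

/-- The vertices `n - k, ..., n - 1` form an induced path, which is the only walk of its length
between its ends. -/
theorem pow_apply_last_ne_zero (hkn : k ≤ n) (hA : SMat (Gnk n k) A) {l : Fin n}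
    (hl : l.val + 1 = n) (d : ℕ) (hd : d < k) (i : Fin n) (hi : i.val + d + 1 = n) :
    (A ^ d) i l ≠ 0 := by
  induction d generalizing i with
  | zero =>
    obtain rfl : i = l := Fin.ext (by omega)
    simp
  | succ d ih =>
    have hs : i.val + 1 < n := by omega
    rw [pow_succ', Matrix.mul_apply, Finset.sum_eq_single (⟨i.val + 1, hs⟩ : Fin n)]
    · refine mul_ne_zero ?_ (ih (by omega) _ (by simp only; omega))
      have hne : i ≠ ⟨i.val + 1, hs⟩ := fun h => by simpa using congrArg Fin.val h
      rw [hA.2 _ _ hne, Gnk_adj]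
      have hval : (⟨i.val + 1, hs⟩ : Fin n).val = i.val + 1 := rfl
      exact ⟨hne, by omega⟩
    · intro j _ hj
      have hj' : j.val ≠ i.val + 1 := fun h => hj (Fin.ext h)
      by_cases hjd : j.val + d + 1 < n
      · rw [pow_apply_last_eq_zero hkn hA hl d hd j hjd, mul_zero]
      · have hij : i ≠ j := by rintro rfl; omega
        have : ¬ (Gnk n k).Adj i j := by rw [Gnk_adj]; omega
        rw [← hA.2 i j hij, not_not] at this
        rw [this, zero_mul]
    · simp

theorem le_qMat_of_SMat_Gnk (hkn : k ≤ n) (hA : SMat (Gnk n k) A) : k ≤ qMat A := by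
  by_contra! hlt
  obtain ⟨P, hmonic, hdeg, hP⟩ := exists_monic_natDegree_eq_qMat hA.1
  have hl : (⟨n - 1, by omega⟩ : Fin n).val + 1 = n := by simp only; omega
  have hi : (⟨n - 1 - qMat A, by omega⟩ : Fin n).val + qMat A + 1 = n := by simp only; omega
  refine pow_apply_last_ne_zero hkn hA hl _ hlt _ hi ?_
  rw [Polynomial.aeval_eq_sum_range, hdeg, Finset.sum_range_succ, ← hdeg, hmonic.coeff_natDegree,
    one_smul, hdeg] at hP
  have h := congrFun (congrFun hP ⟨n - 1 - qMat A, by omega⟩) ⟨n - 1, by omega⟩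
  rw [Matrix.add_apply, Matrix.sum_apply, Finset.sum_eq_zero, zero_add] at h
  · exact h
  · intro d hd
    rw [Finset.mem_range] at hd
    rw [Matrix.smul_apply, pow_apply_last_eq_zero hkn hA hl d (by omega) _ (by simp only; omega),
      smul_zero]

end LowerBound

/-- The incidence matrix of the cover of the edges of `Gnk n k` by `k - 1` cliques: the large clique
and the edges of the path. -/
def cliqueIncMatrix (n k : ℕ) : Matrix (Fin (k - 1)) (Fin n) ℝ := fun r i =>
  if (r.val = 0 ∧ i.val ≤ n - k + 1) ∨
    (0 < r.val ∧ (i.val = n - k + r.val ∨ i.val = n - k + r.val + 1)) then 1 else 0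

theorem cliqueIncMatrix_nonneg (n k : ℕ) (r : Fin (k - 1)) (i : Fin n) :
    0 ≤ cliqueIncMatrix n k r i := by
  rw [cliqueIncMatrix]
  split_ifs <;> norm_num

theorem cliqueIncMatrix_ne_zero {n k : ℕ} {r : Fin (k - 1)} {i : Fin n} :
    cliqueIncMatrix n k r i ≠ 0 ↔ ((r.val = 0 ∧ i.val ≤ n - k + 1) ∨
      (0 < r.val ∧ (i.val = n - k + r.val ∨ i.val = n - k + r.val + 1))) := by
  rw [cliqueIncMatrix]
  split_ifs with h <;> simp [h]

theorem SMat_Gnk_cliqueIncMatrix {n k : ℕ} (hk : 2 ≤ k) (hkn : k ≤ n) :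
    SMat (Gnk n k) ((cliqueIncMatrix n k).transpose * cliqueIncMatrix n k) := by
  refine ⟨by simp [Matrix.IsSymm], fun i j hij => ?_⟩
  have hij' : i.val ≠ j.val := fun h => hij (Fin.ext h)
  have hi := i.isLt
  have hj := j.isLt
  simp only [Matrix.mul_apply, Matrix.transpose_apply]
  rw [ne_eq, Finset.sum_eq_zero_iff_of_nonneg fun r _ =>
    mul_nonneg (cliqueIncMatrix_nonneg n k r i) (cliqueIncMatrix_nonneg n k r j), Gnk_adj]
  simp only [Finset.mem_univ, true_implies, not_forall, ← ne_eq, mul_ne_zero_iff,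
    cliqueIncMatrix_ne_zero]
  constructor
  · rintro ⟨r, h1, h2⟩
    have hr := r.isLt
    exact ⟨hij, by omega⟩
  · rintro ⟨-, h | h | h⟩
    · exact ⟨⟨0, by omega⟩, Or.inl ⟨rfl, h.1⟩, Or.inl ⟨rfl, h.2⟩⟩
    · exact ⟨⟨i.val - (n - k), by omega⟩, by simp only; omega, by simp only; omega⟩
    · exact ⟨⟨j.val - (n - k), by omega⟩, by simp only; omega, by simp only; omega⟩

/-- For `2 ≤ k ≤ n`, `q(G(n,k)) = k`. -/
theorem stmt_8 (n k : ℕ) (hk : 2 ≤ k) (hkn : k ≤ n) : qGraph (Gnk n k) = k := by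
  refine IsLeast.csInf_eq ⟨⟨_, SMat_Gnk_cliqueIncMatrix hk hkn, le_antisymm ?_ ?_⟩, ?_⟩
  · have hrank := (Matrix.rank_mul_le_right (cliqueIncMatrix n k).transpose
      (cliqueIncMatrix n k)).trans (cliqueIncMatrix n k).rank_le_height
    have hq := qMat_le_rank_add_one (SMat_Gnk_cliqueIncMatrix hk hkn).1
    omega
  · exact le_qMat_of_SMat_Gnk hkn (SMat_Gnk_cliqueIncMatrix hk hkn)
  · rintro _ ⟨A, hA, rfl⟩
    exact le_qMat_of_SMat_Gnk hkn hA
end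

section
/- If G is a connected finite simple graph on n ≥ 3 vertices with q(G) = 2, then G has no pendant vertex (no vertex of degree one). -/
/-- A symmetric real matrix whose spectrum is contained in `{a, b}` satisfies
`A ^ 2 = (a + b) A - a b`. -/
lemma Matrix.IsSymm.mul_self_of_spectrum_subset_pair {V : Type*} [Fintype V] [DecidableEq V]
    {A : Matrix V V ℝ} (hA : A.IsSymm) {a b : ℝ} (hs : spectrum ℝ A ⊆ {a, b}) :
    A * A = (a + b) • A - (a * b) • (1 : Matrix V V ℝ) := by
  have hA' : IsSelfAdjoint A := by
    rw [IsSelfAdjoint, Matrix.star_eq_conjTranspose, Matrix.conjTranspose_eq_transpose_of_trivial]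
    exact hA
  let p : Polynomial ℝ := (Polynomial.X - Polynomial.C a) * (Polynomial.X - Polynomial.C b)
  have hp : Polynomial.aeval A p = 0 := by
    rw [← cfc_polynomial p A hA', ← cfc_zero ℝ A]
    refine cfc_congr fun x hx => ?_
    rcases hs hx with rfl | rfl <;> simp [p]
  simp only [p, map_mul, map_sub, Polynomial.aeval_X, Polynomial.aeval_C,
    Algebra.algebraMap_eq_smul_one, sub_mul, mul_sub, smul_mul_assoc, mul_smul_comm, one_mul,
    mul_one, smul_smul] at hp
  rw [← sub_eq_zero, ← hp]
  module

/-- In a connected graph on at least three vertices, the unique neighbour of a vertex `v`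
has a neighbour other than `v`. -/
lemma SimpleGraph.Connected.exists_adj_ne_of_unique_adj {V : Type*} [Fintype V] [DecidableEq V]
    {G : SimpleGraph V} (hG : G.Connected) (hcard : 3 ≤ Fintype.card V) {u v : V}
    (hu : ∀ x, G.Adj v x ↔ x = u) : ∃ w, G.Adj u w ∧ w ≠ v := by
  obtain ⟨x, hx⟩ : ∃ x, x ∉ ({u, v} : Finset V) := by
    by_contra! h
    have := (Finset.card_le_card fun y (_ : y ∈ Finset.univ) => h y).trans Finset.card_le_two
    rw [Finset.card_univ] at this
    omega
  obtain ⟨p⟩ := hG.preconnected v x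
  obtain ⟨d, -, hd, hd'⟩ := p.exists_boundary_dart (({u, v} : Finset V) : Set V) (by simp)
    (by exact_mod_cast hx)
  have hadj := d.adj
  simp only [Finset.coe_insert, Finset.coe_singleton, Set.mem_insert_iff,
    Set.mem_singleton_iff, not_or] at hd hd'
  rcases hd with h | h
  · exact ⟨d.snd, h ▸ hadj, hd'.2⟩
  · rw [h, hu] at hadj
    exact absurd hadj hd'.1

/-- If `G` is connected on at least `3` vertices and `q(G) = 2`,
then `G` has no vertex of degree one. -/
theorem stmt_9 {V : Type*} [Fintype V] [DecidableEq V] (G : SimpleGraph V)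
    [DecidableRel G.Adj]
    (hconn : G.Connected) (hcard : 3 ≤ Fintype.card V) (hq : qGraph G = 2) :
    ∀ v : V, G.degree v ≠ 1 := by
  intro v hv
  obtain ⟨u, hu⟩ := Finset.card_eq_one.mp hv
  replace hu : ∀ x, G.Adj v x ↔ x = u := fun x => by
    rw [← G.mem_neighborFinset, hu, Finset.mem_singleton]
  obtain ⟨w, huw, hwv⟩ := hconn.exists_adj_ne_of_unique_adj hcard hu
  obtain ⟨A, ⟨hA, hAG⟩, hqA⟩ : qGraph G ∈ {k | ∃ A : Matrix V V ℝ, SMat G A ∧ qMat A = k} :=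
    Nat.sInf_mem (Nat.nonempty_of_pos_sInf (by unfold qGraph at hq; omega))
  obtain ⟨a, b, -, hab⟩ := Set.ncard_eq_two.mp (hqA.trans hq)
  have hvw : A v w = 0 := by
    by_contra h
    exact huw.ne ((hu w).mp ((hAG v w hwv.symm).mp h)).symm
  have hentry := congrFun (congrFun (hA.mul_self_of_spectrum_subset_pair hab.subset) v) w
  rw [Matrix.mul_apply, Finset.sum_eq_single u] at hentry
  · have hvu : G.Adj v u := (hu u).mpr rfl
    have h₁ := (hAG v u hvu.ne).mpr hvu
    have h₂ := (hAG u w huw.ne).mpr huw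
    simp [hvw, Matrix.one_apply_ne hwv.symm, h₁, h₂] at hentry
  · intro x _ hxu
    by_cases hxv : x = v
    · rw [hxv, hvw, mul_zero]
    · rw [not_not.mp (mt (hAG v x (Ne.symm hxv)).mp (mt (hu x).mp hxu)), zero_mul]
  · simp
end

section
/- If G is a connected finite simple graph on n ≥ 3 vertices with q(G) = 2, then G has no cut edge, i.e., no edge whose deletion disconnects G. -/
open Matrix in
/-- A real symmetric matrix with exactly two eigenvalues satisfies a monic quadratic equation. -/
theorem exists_mul_self_eq_of_qMat_eq_two {V : Type*} [Fintype V] [DecidableEq V]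
    {A : Matrix V V ℝ} (hA : A.IsSymm) (hq : qMat A = 2) :
    ∃ r s : ℝ, A * A = algebraMap ℝ (Matrix V V ℝ) s + r • A := by
  obtain ⟨a, b, -, hab⟩ := Set.ncard_eq_two.mp hq
  have hsa : IsSelfAdjoint A := by
    rw [isSelfAdjoint_iff, star_eq_conjTranspose, conjTranspose_eq_transpose_of_trivial]
    exact hA
  refine ⟨a + b, -(a * b), ?_⟩
  calc A * A = cfc (fun x : ℝ ↦ x * x) A := by
        rw [cfc_mul (fun x : ℝ ↦ x) (fun x : ℝ ↦ x) A, cfc_id' ℝ A]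
    _ = cfc (fun x : ℝ ↦ -(a * b) + (a + b) * x) A := by
        refine cfc_congr fun x hx ↦ ?_
        rw [hab] at hx
        rcases hx with rfl | rfl <;> ring
    _ = _ := by
        rw [cfc_const_add (-(a * b)) (fun x : ℝ ↦ (a + b) * x) A, cfc_const_mul_id (a + b) A]

/-- If some matrix in `S(G)` satisfies a monic quadratic equation, then the endpoint `u` of a bridge
`uv` has no neighbour other than `v`. -/
theorem SMat.eq_of_isBridge_of_adj {V : Type*} [Fintype V] [DecidableEq V] {G : SimpleGraph V}
    {A : Matrix V V ℝ} (hA : SMat G A) {r s : ℝ}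
    (hquad : A * A = algebraMap ℝ (Matrix V V ℝ) s + r • A) {u v w : V}
    (hbr : G.IsBridge s(u, v)) (huv : G.Adj u v) (huw : G.Adj u w) : w = v := by
  by_contra hwv
  rw [SimpleGraph.isBridge_iff] at hbr
  have step {x y : V} (h : G.Adj x y) (hne : s(x, y) ≠ s(u, v)) :
      (G.deleteEdges {s(u, v)}).Reachable x y :=
    SimpleGraph.Adj.reachable (by simpa [SimpleGraph.deleteEdges_adj, h] using hne)
  have hruw := step huw (by grind)
  have hnadj : ¬ G.Adj w v := fun h ↦ hbr (hruw.trans (step h (by grind [huw.ne])))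
  have hzero : A w v = 0 := by
    by_contra h
    exact hnadj ((hA.2 w v hwv).mp h)
  have hsum : (A * A) w v = A w u * A u v := by
    rw [Matrix.mul_apply]
    refine Finset.sum_eq_single u (fun k _ hku ↦ ?_) (by simp)
    by_contra hk
    obtain ⟨h₁, h₂⟩ := mul_ne_zero_iff.mp hk
    have hkw : w ≠ k := by rintro rfl; exact h₂ hzero
    have hkv : k ≠ v := by rintro rfl; exact h₁ hzero
    exact hbr ((hruw.trans (step ((hA.2 w k hkw).mp h₁) (by grind))).trans
      (step ((hA.2 k v hkv).mp h₂) (by grind)))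
  rw [hquad, Matrix.add_apply, Matrix.smul_apply, hzero, smul_zero, add_zero,
    Matrix.algebraMap_matrix_apply, if_neg hwv] at hsum
  exact mul_ne_zero ((hA.2 w u huw.ne').mpr huw.symm) ((hA.2 u v huv.ne).mpr huv) hsum.symm

/-- In a connected graph on at least three vertices, for any two vertices some edge joins one of
them to a third vertex. -/
theorem SimpleGraph.Connected.exists_adj_of_three_le_card {V : Type*} [Fintype V] [DecidableEq V]
    {G : SimpleGraph V} (hconn : G.Connected) (hcard : 3 ≤ Fintype.card V) (u v : V) :
    ∃ w, w ≠ u ∧ w ≠ v ∧ (G.Adj u w ∨ G.Adj v w) := by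
  obtain ⟨x, hx⟩ : ∃ x, x ∉ ({u, v} : Finset V) := by
    by_contra! h
    have := Finset.card_le_two (a := u) (b := v)
    rw [Finset.eq_univ_iff_forall.mpr h, Finset.card_univ] at this
    omega
  obtain ⟨p⟩ := hconn.preconnected u x
  obtain ⟨d, -, hd₁, hd₂⟩ := p.exists_boundary_dart ({u, v} : Set V) (by simp) (by simpa using hx)
  have hadj := d.adj
  simp only [Set.mem_insert_iff, Set.mem_singleton_iff, not_or] at hd₁ hd₂
  refine ⟨d.snd, hd₂.1, hd₂.2, ?_⟩
  rcases hd₁ with h | h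
  · exact .inl (h ▸ hadj)
  · exact .inr (h ▸ hadj)

/-- If `G` is connected on at least `3` vertices and `q(G) = 2`,
then `G` has no cut edge (bridge). -/
theorem stmt_10 {V : Type*} [Fintype V] [DecidableEq V] (G : SimpleGraph V)
    (hconn : G.Connected) (hcard : 3 ≤ Fintype.card V) (hq : qGraph G = 2) :
    ∀ e : Sym2 V, ¬ G.IsBridge e := by
  intro e hbr
  have hne : {k | ∃ A : Matrix V V ℝ, SMat G A ∧ qMat A = k}.Nonempty :=
    Nat.nonempty_of_pos_sInf (by change 0 < qGraph G; omega)
  obtain ⟨A, hA, hqA⟩ := Nat.sInf_mem hne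
  obtain ⟨r, s, hquad⟩ := exists_mul_self_eq_of_qMat_eq_two hA.1 (hqA.trans hq)
  induction e with | h u v =>
  have huv : G.Adj u v := hbr.reachable_iff_adj.mp (hconn.preconnected u v)
  obtain ⟨w, hwu, hwv, h | h⟩ := hconn.exists_adj_of_three_le_card hcard u v
  · exact hwv (hA.eq_of_isBridge_of_adj hquad hbr huv h)
  · exact hwu (hA.eq_of_isBridge_of_adj hquad (Sym2.eq_swap ▸ hbr) huv.symm h)
end

section
/- Let n ≥ 2 and let G be the graph obtained from the complete graph K_n by deleting a single edge. Then q(G) = 1 if n = 2, q(G) = 3 if n = 3, and q(G) = 2 if n ≥ 4. -/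
namespace QGraph

open Matrix

theorem isHermitian_of_isSymm {V : Type*} {A : Matrix V V ℝ} (h : A.IsSymm) : A.IsHermitian := by
  rw [IsHermitian, conjTranspose_eq_transpose_of_trivial]
  exact h

variable {V : Type*} [Fintype V] [DecidableEq V]

theorem finite_spectrum {A : Matrix V V ℝ} (h : A.IsSymm) : (spectrum ℝ A).Finite := by
  rw [(isHermitian_of_isSymm h).spectrum_real_eq_range_eigenvalues]
  exact Set.finite_range _

theorem qMat_le_card {A : Matrix V V ℝ} (h : A.IsSymm) : qMat A ≤ Fintype.card V := by
  rw [qMat, (isHermitian_of_isSymm h).spectrum_real_eq_range_eigenvalues, ← Set.image_univ]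
  exact (Set.ncard_image_le Set.finite_univ).trans (by simp [Set.ncard_univ])

theorem one_le_qMat [Nonempty V] {A : Matrix V V ℝ} (h : A.IsSymm) : 1 ≤ qMat A := by
  rw [qMat, Nat.one_le_iff_ne_zero, Ne, Set.ncard_eq_zero (finite_spectrum h),
    (isHermitian_of_isSymm h).spectrum_real_eq_range_eigenvalues]
  exact (Set.range_nonempty _).ne_empty

/-- A symmetric matrix with all eigenvalues in `{a, b}` is annihilated by `(X - a) (X - b)`. -/
theorem mul_self_of_spectrum_subset_pair {A : Matrix V V ℝ} (h : A.IsSymm) {a b : ℝ}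
    (hs : spectrum ℝ A ⊆ {a, b}) : A * A = (a + b) • A - (a * b) • 1 := by
  have hA := isHermitian_of_isSymm h
  have hev : ∀ i, hA.eigenvalues i = a ∨ hA.eigenvalues i = b := fun i ↦ by
    have : hA.eigenvalues i ∈ spectrum ℝ A := by
      rw [hA.spectrum_real_eq_range_eigenvalues]
      exact Set.mem_range_self i
    simpa using hs this
  apply (toEuclideanLin (𝕜 := ℝ) (m := V) (n := V)).injective
  apply hA.eigenvectorBasis.toBasis.ext
  intro i
  have hi := hA.mulVec_eigenvectorBasis i
  ext j
  simp only [OrthonormalBasis.coe_toBasis, toLpLin_apply, sub_mulVec, smul_mulVec, one_mulVec,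
    ← mulVec_mulVec, hi, mulVec_smul]
  simp only [Pi.smul_apply, Pi.sub_apply, smul_eq_mul]
  rcases hev i with e | e <;> rw [e] <;> ring

/-- A symmetric matrix with only one eigenvalue is scalar. -/
theorem apply_eq_zero_of_qMat_le_one {A : Matrix V V ℝ} (h : A.IsSymm) (hq : qMat A ≤ 1)
    {i j : V} (hij : i ≠ j) : A i j = 0 := by
  obtain ⟨a, ha⟩ : ∃ a, spectrum ℝ A ⊆ {a} := by
    rcases Set.eq_empty_or_nonempty (spectrum ℝ A) with h0 | ⟨a, ha⟩
    · exact ⟨0, by simp [h0]⟩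
    · exact ⟨a, fun b hb ↦ (Set.ncard_le_one (finite_spectrum h)).1 hq b hb a ha⟩
  have hsq := mul_self_of_spectrum_subset_pair h (a := a) (b := a) (by simpa using ha)
  have hB : (A - a • 1)ᴴ * (A - a • 1) = 0 := by
    rw [conjTranspose_eq_transpose_of_trivial, transpose_sub, h.eq, transpose_smul, transpose_one]
    simp only [sub_mul, mul_sub, hsq, smul_mul_assoc, mul_smul_comm, one_mul, mul_one, add_smul,
      mul_smul]
    module
  have := congrFun (congrFun (conjTranspose_mul_self_eq_zero.1 hB) i) j
  simpa [hij] using this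

theorem exists_pair_of_qMat_le_two {A : Matrix V V ℝ} (h : A.IsSymm) (hq : qMat A ≤ 2) :
    ∃ a b, spectrum ℝ A ⊆ {a, b} := by
  rcases Nat.lt_or_ge (qMat A) 2 with h1 | h2
  · rcases Set.eq_empty_or_nonempty (spectrum ℝ A) with h0 | ⟨a, ha⟩
    · exact ⟨0, 0, by simp [h0]⟩
    · exact ⟨a, a, fun b hb ↦ by
        simpa using (Set.ncard_le_one (finite_spectrum h)).1 (Nat.lt_succ_iff.1 h1) b hb a ha⟩
  · obtain ⟨a, b, -, e⟩ := Set.ncard_eq_two.1 (le_antisymm hq h2)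
    exact ⟨a, b, e.subset⟩

theorem qMat_le_two_of_mul_self {A : Matrix V V ℝ} {c : ℝ} (hc : A * A = c • A) :
    qMat A ≤ 2 := by
  have hs : spectrum ℝ A ⊆ {0, c} := by
    intro x hx
    rw [← spectrum_toLin', ← Module.End.hasEigenvalue_iff_mem_spectrum] at hx
    obtain ⟨v, hv⟩ := hx.exists_hasEigenvector
    have e : A *ᵥ v = x • v := by simpa using hv.apply_eq_smul
    have e2 : (x * x - c * x) • v = 0 := by
      have := congrArg (· *ᵥ v) hc
      simp only [← mulVec_mulVec, smul_mulVec, e, mulVec_smul, smul_smul] at this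
      rw [sub_smul, this, sub_self]
    have e3 := (smul_eq_zero.1 e2).resolve_right hv.2
    have : x * (x - c) = 0 := by linarith
    simpa [sub_eq_zero] using this
  exact (Set.ncard_le_ncard hs (Set.toFinite _)).trans (by simpa using Set.ncard_insert_le 0 {c})

theorem qGraph_eq {G : SimpleGraph V} {k : ℕ} {A : Matrix V V ℝ} (hA : SMat G A)
    (hk : qMat A ≤ k) (h : ∀ B : Matrix V V ℝ, SMat G B → k ≤ qMat B) : qGraph G = k := by
  have hmem : qMat A ∈ {k | ∃ A : Matrix V V ℝ, SMat G A ∧ qMat A = k} := ⟨A, hA, rfl⟩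
  refine le_antisymm ((Nat.sInf_le hmem).trans hk) ?_
  refine le_csInf ⟨_, hmem⟩ ?_
  rintro _ ⟨B, hB, rfl⟩
  exact h B hB

theorem sMat_adjMatrix (G : SimpleGraph V) [DecidableRel G.Adj] : SMat G (G.adjMatrix ℝ) :=
  ⟨G.isSymm_adjMatrix, fun i j _ ↦ by simp [SimpleGraph.adjMatrix_apply]⟩

/-- First coordinates of a tight frame of `n + 4` vectors in the plane whose only orthogonal
pair is the first two vectors. -/
noncomputable def frameFst (n : ℕ) (i : Fin (n + 4)) : ℝ :=
  if i.val = 0 then 1 / 2 else if i.val = 1 then 0 else if i.val = 2 then 2 * (n + 1) else 1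

/-- Second coordinates of the frame of `frameFst`. -/
noncomputable def frameSnd (n : ℕ) (i : Fin (n + 4)) : ℝ :=
  if i.val = 0 then 0 else if i.val = 1 then 2 * (n + 1) else if i.val = 2 then -1 / 2 else 1

/-- The Gram matrix of the frame given by `frameFst` and `frameSnd`. -/
noncomputable def frameGram (n : ℕ) : Matrix (Fin (n + 4)) (Fin (n + 4)) ℝ :=
  of fun i j ↦ frameFst n i * frameFst n j + frameSnd n i * frameSnd n j

theorem frameGram_mul_self (n : ℕ) :
    frameGram n * frameGram n = (1 / 4 + 4 * (n + 1) ^ 2 + (n + 1) : ℝ) • frameGram n := by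
  have hxx : ∑ k, frameFst n k * frameFst n k = 1 / 4 + 4 * (n + 1) ^ 2 + (n + 1) := by
    simp [Fin.sum_univ_succ, frameFst]
    ring
  have hyy : ∑ k, frameSnd n k * frameSnd n k = 1 / 4 + 4 * (n + 1) ^ 2 + (n + 1) := by
    simp [Fin.sum_univ_succ, frameSnd]
    ring
  have hxy : ∑ k, frameFst n k * frameSnd n k = 0 := by
    simp [Fin.sum_univ_succ, frameFst, frameSnd]
    ring
  ext i j
  have : ∀ k, frameGram n i k * frameGram n k j =
      frameFst n i * frameFst n j * (frameFst n k * frameFst n k) +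
      frameSnd n i * frameSnd n j * (frameSnd n k * frameSnd n k) +
      (frameFst n i * frameSnd n j + frameSnd n i * frameFst n j) *
        (frameFst n k * frameSnd n k) := fun k ↦ by
    simp only [frameGram, of_apply]
    ring
  simp only [mul_apply, this, Finset.sum_add_distrib, ← Finset.mul_sum, hxx, hyy, hxy, Matrix.smul_apply,
    smul_eq_mul]
  simp only [frameGram, of_apply]
  ring

theorem sMat_frameGram (n : ℕ) :
    SMat ((⊤ : SimpleGraph (Fin (n + 4))).deleteEdges {s(⟨0, by omega⟩, ⟨1, by omega⟩)})
      (frameGram n) := by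
  refine ⟨by ext i j; simp [frameGram, mul_comm], fun i j hij ↦ ?_⟩
  have hn : (0 : ℝ) ≤ n := n.cast_nonneg
  have hv : i.val ≠ j.val := Fin.val_ne_of_ne hij
  simp only [SimpleGraph.deleteEdges_adj, SimpleGraph.top_adj, Set.mem_singleton_iff, Sym2.eq_iff,
    Fin.ext_iff, frameGram, of_apply, frameFst, frameSnd]
  split_ifs <;> first
    | omega
    | (simp_all; done)
    | (refine iff_of_true ?_ ⟨hij, by omega⟩; apply ne_of_gt; nlinarith)
    | (refine iff_of_true ?_ ⟨hij, by omega⟩; apply ne_of_lt; nlinarith)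

end QGraph

/-- Let `G` be the complete graph on `n ≥ 2` vertices with a single edge deleted.
Then `q(G) = 1` if `n = 2`, `q(G) = 3` if `n = 3`, and `q(G) = 2` if `n ≥ 4`. -/
theorem stmt_13 (n : ℕ) (hn : 2 ≤ n) :
    qGraph ((⊤ : SimpleGraph (Fin n)).deleteEdges
        {s((⟨0, by omega⟩ : Fin n), (⟨1, by omega⟩ : Fin n))}) =
      if n = 2 then 1 else if n = 3 then 3 else 2 := by
  split_ifs with h2 h3
  · subst h2
    refine QGraph.qGraph_eq (A := 0) ⟨Matrix.isSymm_zero, fun i j hij ↦ ?_⟩ ?_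
      fun B hB ↦ QGraph.one_le_qMat hB.1
    · fin_cases i <;> fin_cases j <;> simp_all
    · simp [qMat, spectrum.zero_eq]
  · subst h3
    classical
    refine QGraph.qGraph_eq (QGraph.sMat_adjMatrix _)
      ((QGraph.qMat_le_card (QGraph.sMat_adjMatrix _).1).trans (by simp)) fun B hB ↦ ?_
    by_contra! hq
    obtain ⟨a, b, hab⟩ := QGraph.exists_pair_of_qMat_le_two hB.1 (Nat.lt_succ_iff.1 hq)
    have h01 : B 0 1 = 0 := by
      by_contra h
      simpa using (hB.2 0 1 (by decide)).1 h
    have h02 : B 0 2 ≠ 0 := (hB.2 0 2 (by decide)).2 (by simp)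
    have h21 : B 2 1 ≠ 0 := (hB.2 2 1 (by decide)).2 (by simp)
    have := congrFun (congrFun (QGraph.mul_self_of_spectrum_subset_pair hB.1 hab) 0) 1
    simp [Matrix.mul_apply, Fin.sum_univ_three, h01, h02, h21] at this
  · obtain ⟨m, rfl⟩ : ∃ m, n = m + 4 := ⟨n - 4, by omega⟩
    refine QGraph.qGraph_eq (QGraph.sMat_frameGram m)
      (QGraph.qMat_le_two_of_mul_self (QGraph.frameGram_mul_self m)) fun B hB ↦ ?_
    by_contra! hq
    have h02 : (⟨0, by omega⟩ : Fin (m + 4)) ≠ ⟨2, by omega⟩ := by simp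
    refine (hB.2 _ _ h02).2 ?_
      (QGraph.apply_eq_zero_of_qMat_le_one hB.1 (Nat.lt_succ_iff.1 hq) h02)
    simp [Fin.ext_iff]
end

section
/- For any integers m, n with 1 ≤ m ≤ n, the complete bipartite graph K_{m,n} satisfies q(K_{m,n}) = 2 if m = n, and q(K_{m,n}) = 3 if m < n. -/
open Polynomial Matrix

/-- A polynomial vanishing on the spectrum of a real symmetric matrix annihilates it. -/
theorem aeval_eq_zero_of_eval_spectrum {V : Type*} [Fintype V] [DecidableEq V]
    {A : Matrix V V ℝ} (hA : A.IsSymm) (p : ℝ[X]) (hp : ∀ x ∈ spectrum ℝ A, p.eval x = 0) :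
    aeval A p = 0 := by
  have hsa : IsSelfAdjoint A := by
    rw [IsSelfAdjoint, star_eq_conjTranspose, conjTranspose_eq_transpose_of_trivial]
    exact hA
  rw [← cfc_polynomial p A hsa, cfc_congr (g := fun _ => (0 : ℝ)) hp, cfc_const_zero]

/-- The spectrum of a real matrix consists of roots of any annihilating polynomial. -/
theorem eval_eq_zero_of_aeval_eq_zero {V : Type*} [Fintype V] [DecidableEq V] [Nonempty V]
    {A : Matrix V V ℝ} {p : ℝ[X]} (hp : aeval A p = 0) {x : ℝ} (hx : x ∈ spectrum ℝ A) :
    p.eval x = 0 := by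
  have h := spectrum.subset_polynomial_aeval A p ⟨x, hx, rfl⟩
  simpa [hp] using h

theorem Set.Finite.exists_subset_pair {s : Set ℝ} (hs : s.Finite) (h : s.ncard ≤ 2) :
    ∃ a b, s ⊆ {a, b} := by
  interval_cases h' : s.ncard
  · rw [Set.ncard_eq_zero hs] at h'
    exact ⟨0, 0, by simp [h']⟩
  · obtain ⟨a, rfl⟩ := Set.ncard_eq_one.mp h'
    exact ⟨a, a, by simp⟩
  · obtain ⟨a, b, -, rfl⟩ := Set.ncard_eq_two.mp h'
    exact ⟨a, b, subset_rfl⟩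

theorem Set.Finite.exists_subset_singleton {s : Set ℝ} (hs : s.Finite) (h : s.ncard ≤ 1) :
    ∃ a, s ⊆ {a} := by
  interval_cases h' : s.ncard
  · rw [Set.ncard_eq_zero hs] at h'
    exact ⟨0, by simp [h']⟩
  · obtain ⟨a, rfl⟩ := Set.ncard_eq_one.mp h'
    exact ⟨a, subset_rfl⟩

/-- There are nowhere-zero orthogonal matrices of every positive size. -/
theorem exists_orthogonal_forall_ne_zero (n : ℕ) (hn : 1 ≤ n) :
    ∃ Q : Matrix (Fin n) (Fin n) ℝ, Q * Qᵀ = 1 ∧ ∀ i j, Q i j ≠ 0 := by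
  obtain ⟨k, rfl⟩ : ∃ k, n = k + 1 := ⟨n - 1, by omega⟩
  set v : Fin (k + 1) → ℝ := fun i => if i = 0 then (k : ℝ) + 2 else 1 with hv
  set s : ℝ := v ⬝ᵥ v with hs
  have hk : (0 : ℝ) ≤ k := k.cast_nonneg
  have hs' : s = ((k : ℝ) + 2) ^ 2 + k := by
    simp [hs, hv, dotProduct, Fin.sum_univ_succ, pow_two]
  have hs0 : s ≠ 0 := by rw [hs']; positivity
  have hv0 : ∀ i, v i ≠ 0 := by
    intro i
    by_cases h : i = 0
    · simp only [hv, h, if_true]; positivity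
    · simp [hv, h]
  refine ⟨1 - (2 / s) • vecMulVec v v, ?_, fun i j => ?_⟩
  · have hsq : vecMulVec v v * vecMulVec v v = s • vecMulVec v v := by
      rw [vecMulVec_mul_vecMulVec, ← hs]
      ext i j
      simp [vecMulVec_apply, mul_left_comm]
    have ht : (vecMulVec v v)ᵀ = vecMulVec v v := by
      ext i j
      simp [vecMulVec_apply, mul_comm]
    rw [transpose_sub, transpose_smul, ht, transpose_one, sub_mul, mul_sub, mul_sub,
      smul_mul_smul_comm, hsq, smul_smul, one_mul, mul_one, one_mul,
      show 2 / s * (2 / s) * s = 2 / s + 2 / s by field_simp; ring, add_smul]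
    abel
  · by_cases hij : i = j
    · subst hij
      simp only [Matrix.sub_apply, one_apply_eq, Matrix.smul_apply, vecMulVec_apply, smul_eq_mul]
      intro h
      have h' : s = 2 * (v i * v i) := by field_simp at h; linarith
      rw [hs'] at h'
      by_cases hi : i = 0
      · simp only [hv, hi, if_true] at h'; nlinarith
      · simp only [hv, hi, if_false] at h'; nlinarith
    · simp [Matrix.sub_apply, one_apply_ne hij, vecMulVec_apply, hs0, hv0]

theorem spectrum_finite {V : Type*} [Fintype V] [DecidableEq V] [Nonempty V]
    (A : Matrix V V ℝ) : (spectrum ℝ A).Finite := by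
  refine Set.Finite.subset (A.charpoly.rootSet_finite ℝ) fun x hx => ?_
  rw [mem_rootSet]
  refine ⟨A.charpoly_monic.ne_zero, ?_⟩
  rw [coe_aeval_eq_eval]
  exact eval_eq_zero_of_aeval_eq_zero (aeval_self_charpoly A) hx

theorem two_le_qMat {V : Type*} [Fintype V] [DecidableEq V] {G : SimpleGraph V}
    {A : Matrix V V ℝ} (hA : SMat G A) {i j : V} (hij : G.Adj i j) : 2 ≤ qMat A := by
  by_contra! h
  have : Nonempty V := ⟨i⟩
  obtain ⟨a, ha⟩ := (spectrum_finite A).exists_subset_singleton (Nat.le_of_lt_succ h)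
  have h0 := aeval_eq_zero_of_eval_spectrum hA.1 (X - C a) fun x hx => by
    simp [Set.mem_singleton_iff.mp (ha hx)]
  have h1 := congrFun (congrFun h0 i) j
  simp only [map_sub, aeval_X, aeval_C, algebraMap_eq_diagonal, Matrix.sub_apply,
    diagonal_apply_ne _ hij.ne, Matrix.zero_apply, sub_zero] at h1
  exact (hA.2 i j hij.ne).mpr hij h1

/-- Two distinct eigenvalues force the two parts of a complete bipartite graph to have the
same size. -/
theorem card_eq_of_qMat_le_two {m n : ℕ} (hm : 1 ≤ m) (hn : 1 ≤ n)
    {A : Matrix (Fin m ⊕ Fin n) (Fin m ⊕ Fin n) ℝ}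
    (hA : SMat (completeBipartiteGraph (Fin m) (Fin n)) A) (h : qMat A ≤ 2) : m = n := by
  let i₀ : Fin m := ⟨0, hm⟩
  let j₀ : Fin n := ⟨0, hn⟩
  have : Nonempty (Fin m ⊕ Fin n) := ⟨Sum.inl i₀⟩
  obtain ⟨a, b, hab⟩ := (spectrum_finite A).exists_subset_pair h
  have h0 := aeval_eq_zero_of_eval_spectrum hA.1 ((X - C a) * (X - C b)) fun x hx => by
    rcases hab hx with rfl | rfl <;> simp
  simp only [map_mul, map_sub, aeval_X, aeval_C, Algebra.algebraMap_eq_smul_one] at h0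
  have hsq : A * A = (a + b) • A - (a * b) • 1 := by
    have : (A - a • 1) * (A - b • 1) = A * A - (a + b) • A + (a * b) • 1 := by
      simp only [sub_mul, mul_sub, smul_mul_assoc, mul_smul_comm, one_mul, mul_one, smul_smul,
        add_smul, smul_sub, mul_comm b a]
      abel
    rw [this] at h0
    rw [← sub_eq_zero, ← h0]
    abel
  have hsymm : ∀ x y, A x y = A y x := fun x y => hA.1.apply y x
  set B : Matrix (Fin m) (Fin n) ℝ := of fun i j => A (Sum.inl i) (Sum.inr j) with hB
  have hB0 : ∀ i j, B i j ≠ 0 := fun i j => (hA.2 _ _ (by simp)).mpr (by simp)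
  have hl : ∀ i i' : Fin m, i ≠ i' → A (Sum.inl i) (Sum.inl i') = 0 := fun i i' hi => by
    by_contra hne
    simpa using (hA.2 _ _ (by simpa using hi)).mp hne
  have hr : ∀ j j' : Fin n, j ≠ j' → A (Sum.inr j) (Sum.inr j') = 0 := fun j j' hj => by
    by_contra hne
    simpa using (hA.2 _ _ (by simpa using hj)).mp hne
  have hmul : ∀ x y, ∑ i, A x (Sum.inl i) * A (Sum.inl i) y + ∑ j, A x (Sum.inr j) *
      A (Sum.inr j) y = (a + b) * A x y - a * b * (1 : Matrix _ _ ℝ) x y := fun x y => by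
    have := congrFun (congrFun hsq x) y
    simpa [Matrix.mul_apply, Fintype.sum_sum_type] using this
  have hdiag : ∀ i j, A (Sum.inl i) (Sum.inl i) + A (Sum.inr j) (Sum.inr j) = a + b := by
    intro i j
    have := hmul (Sum.inl i) (Sum.inr j)
    rw [Finset.sum_eq_single i (fun k _ hk => by rw [hl i k hk.symm, zero_mul]) (by simp),
      Finset.sum_eq_single j (fun k _ hk => by rw [hr k j hk, mul_zero]) (by simp),
      one_apply_ne (by simp)] at this
    apply mul_right_cancel₀ (hB0 i j)
    simp only [hB, of_apply]
    linarith
  set c := A (Sum.inl i₀) (Sum.inl i₀)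
  set d := A (Sum.inr j₀) (Sum.inr j₀)
  have hc : ∀ i, A (Sum.inl i) (Sum.inl i) = c := fun i => by
    linarith [hdiag i j₀, hdiag i₀ j₀]
  have hd : ∀ j, A (Sum.inr j) (Sum.inr j) = d := fun j => by
    linarith [hdiag i₀ j, hdiag i₀ j₀]
  have hrow : B * Bᵀ = ((a + b) * c - a * b - c * c) • 1 := by
    ext i i'
    have := hmul (Sum.inl i) (Sum.inl i')
    rw [Finset.sum_eq_single i (fun k _ hk => by rw [hl i k hk.symm, zero_mul]) (by simp)] at this
    simp only [fun j => hsymm (Sum.inr j) (Sum.inl i'), hc] at this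
    simp only [Matrix.mul_apply, transpose_apply, Matrix.smul_apply, smul_eq_mul, hB, of_apply]
    by_cases hii : i = i'
    · subst hii
      rw [hc, one_apply_eq] at this
      rw [one_apply_eq]
      linarith
    · rw [hl i i' hii, one_apply_ne (by simpa using hii)] at this
      rw [one_apply_ne hii]
      linarith
  have hcol : Bᵀ * B = ((a + b) * d - a * b - d * d) • 1 := by
    ext j j'
    have := hmul (Sum.inr j) (Sum.inr j')
    rw [Finset.sum_eq_single j (fun k _ hk => by rw [hr j k hk.symm, zero_mul]) (by simp)] at this
    simp only [fun i => hsymm (Sum.inr j) (Sum.inl i), hd] at this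
    simp only [Matrix.mul_apply, transpose_apply, Matrix.smul_apply, smul_eq_mul, hB, of_apply]
    by_cases hjj : j = j'
    · subst hjj
      rw [hd, one_apply_eq] at this
      rw [one_apply_eq]
      linarith
    · rw [hr j j' hjj, one_apply_ne (by simpa using hjj)] at this
      rw [one_apply_ne hjj]
      linarith
  set s := (a + b) * c - a * b - c * c
  have hst : (a + b) * d - a * b - d * d = s := by
    have hBBB : B * Bᵀ * B = B * (Bᵀ * B) := Matrix.mul_assoc _ _ _
    rw [hrow, hcol] at hBBB
    have := congrFun (congrFun hBBB i₀) j₀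
    simp only [Matrix.smul_mul, Matrix.one_mul, Matrix.mul_smul, Matrix.mul_one, Matrix.smul_apply, smul_eq_mul] at this
    exact (mul_right_cancel₀ (hB0 i₀ j₀) this).symm
  have hs0 : s ≠ 0 := by
    intro hs
    have := congrFun (congrFun hrow i₀) i₀
    rw [hs, zero_smul, Matrix.mul_apply, Matrix.zero_apply, Finset.sum_eq_zero_iff_of_nonneg
      (fun j _ => by rw [transpose_apply]; exact mul_self_nonneg _)] at this
    exact hB0 i₀ j₀ (by simpa using this j₀ (Finset.mem_univ _))
  have htr := trace_mul_comm B Bᵀ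
  rw [hrow, hcol, hst] at htr
  simp only [trace_smul, trace_one, Fintype.card_fin, smul_eq_mul] at htr
  exact_mod_cast mul_left_cancel₀ hs0 htr

theorem fromBlocks_mem_SMat {m n : ℕ} {B : Matrix (Fin m) (Fin n) ℝ} (hB : ∀ i j, B i j ≠ 0) :
    SMat (completeBipartiteGraph (Fin m) (Fin n)) (fromBlocks 0 B Bᵀ 0) := by
  refine ⟨by simp [IsSymm, fromBlocks_transpose], ?_⟩
  rintro (i | i) (j | j) - <;> simp [hB]

/-- For `1 ≤ m ≤ n`, `q(K_{m,n}) = 2` if `m = n` and `q(K_{m,n}) = 3` if `m < n`. -/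
theorem stmt_16 (m n : ℕ) (hm : 1 ≤ m) (hmn : m ≤ n) :
    qGraph (completeBipartiteGraph (Fin m) (Fin n)) = if m = n then 2 else 3 := by
  have hn : 1 ≤ n := hm.trans hmn
  obtain ⟨Q, hQ, hQ0⟩ := exists_orthogonal_forall_ne_zero n hn
  have : Nonempty (Fin m ⊕ Fin n) := ⟨Sum.inl ⟨0, hm⟩⟩
  have hadj : (completeBipartiteGraph (Fin m) (Fin n)).Adj
      (Sum.inl (⟨0, hm⟩ : Fin m)) (Sum.inr (⟨0, hn⟩ : Fin n)) := by simp
  have key : ∀ k A, SMat (completeBipartiteGraph (Fin m) (Fin n)) A → qMat A ≤ k →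
      (∀ A, SMat (completeBipartiteGraph (Fin m) (Fin n)) A → k ≤ qMat A) →
      qGraph (completeBipartiteGraph (Fin m) (Fin n)) = k := by
    intro k A hA hk hlow
    have hle : qGraph (completeBipartiteGraph (Fin m) (Fin n)) ≤ qMat A :=
      Nat.sInf_le (Set.mem_ofPred.mpr ⟨A, hA, rfl⟩)
    refine le_antisymm (hle.trans hk) (le_csInf ⟨qMat A, A, hA, rfl⟩ ?_)
    rintro _ ⟨A', hA', rfl⟩
    exact hlow A' hA'
  split_ifs with h
  · subst h
    refine key 2 _ (fromBlocks_mem_SMat hQ0) ?_ fun A hA => two_le_qMat hA hadj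
    have hsub : spectrum ℝ (fromBlocks 0 Q Qᵀ 0) ⊆ {1, -1} := fun x hx => by
      have h1 := eval_eq_zero_of_aeval_eq_zero (p := X ^ 2 - 1) (by
        simp [pow_two, fromBlocks_multiply, hQ, mul_eq_one_comm.mp hQ]) hx
      simpa [sub_eq_zero] using h1
    exact (Set.ncard_le_ncard hsub (Set.toFinite _)).trans
      ((Set.ncard_insert_le _ _).trans (by simp))
  · set B : Matrix (Fin m) (Fin n) ℝ := Q.submatrix (Fin.castLE hmn) id with hB
    have hBB : B * Bᵀ = 1 := by
      rw [hB, transpose_submatrix, ← submatrix_mul _ _ _ id _ Function.bijective_id, hQ]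
      exact submatrix_one _ (Fin.castLE_injective hmn)
    refine key 3 _ (fromBlocks_mem_SMat (B := B) fun i j => hQ0 _ _) ?_ fun A hA => ?_
    · have hsub : spectrum ℝ (fromBlocks 0 B Bᵀ 0) ⊆ {0, 1, -1} := fun x hx => by
        have h1 := eval_eq_zero_of_aeval_eq_zero (p := X * (X ^ 2 - 1)) (by
          simp [pow_two, mul_sub, fromBlocks_multiply, hBB, ← Matrix.mul_assoc]) hx
        simpa [sub_eq_zero] using h1
      refine (Set.ncard_le_ncard hsub (Set.toFinite _)).trans ?_
      exact (Set.ncard_insert_le _ _).trans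
        (Nat.succ_le_succ ((Set.ncard_insert_le _ _).trans (by simp)))
    · by_contra! hlt
      exact h (card_eq_of_qMat_le_two hm hn hA (Nat.le_of_lt_succ hlt))
end

section
/- Let G be a finite simple graph with at least one edge. Then the Cartesian product of G with K_2 satisfies q(G □ K_2) ≤ 2·q(G) − 2. -/
open scoped Kronecker

section SymmetricMatrices

variable {V : Type*} [Fintype V] [DecidableEq V] {G : SimpleGraph V} {A : Matrix V V ℝ}

lemma qGraph_le (hA : SMat G A) : qGraph G ≤ qMat A :=
  Nat.sInf_le ⟨A, hA, rfl⟩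

variable (G) in
lemma exists_qMat_eq_qGraph : ∃ A : Matrix V V ℝ, SMat G A ∧ qMat A = qGraph G := by
  classical
  refine Nat.sInf_mem (s := {k | ∃ A : Matrix V V ℝ, SMat G A ∧ qMat A = k})
    ⟨_, G.adjMatrix ℝ, ⟨G.isSymm_adjMatrix, fun i j _ => ?_⟩, rfl⟩
  simp [SimpleGraph.adjMatrix_apply]

lemma SMat.isSelfAdjoint (hA : SMat G A) : IsSelfAdjoint A := by
  rw [isSelfAdjoint_iff, Matrix.star_eq_conjTranspose, Matrix.conjTranspose_eq_transpose_of_trivial]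
  exact hA.1

/-- The eigenvalues of `A` are not all equal if `G` has an edge. -/
lemma SMat.spectrum_nontrivial (hA : SMat G A) (h : G.edgeSet.Nonempty) :
    (spectrum ℝ A).Nontrivial := by
  by_contra hs
  rw [Set.not_nontrivial_iff] at hs
  obtain ⟨c, hc⟩ : ∃ c, spectrum ℝ A ⊆ {c} := by
    obtain h0 | ⟨c, hc⟩ := hs.eq_empty_or_singleton
    · exact ⟨0, by simp [h0]⟩
    · exact ⟨c, hc.le⟩
  have hAc := CFC.eq_algebraMap_of_spectrum_subset_singleton A c hc hA.isSelfAdjoint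
  obtain ⟨e, he⟩ := h
  induction e with
  | _ i j =>
    have hij : G.Adj i j := he
    refine (hA.2 i j hij.ne).2 hij ?_
    rw [hAc, Matrix.algebraMap_matrix_apply, if_neg hij.ne]

lemma SMat.sub_algebraMap (hA : SMat G A) (c : ℝ) :
    SMat G (A - algebraMap ℝ (Matrix V V ℝ) c) := by
  refine ⟨hA.1.sub ?_, fun i j hij => ?_⟩
  · rw [Matrix.algebraMap_eq_diagonal]
    exact Matrix.isSymm_diagonal _
  · rw [Matrix.sub_apply, Matrix.algebraMap_matrix_apply, if_neg hij, sub_zero]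
    exact hA.2 i j hij

/-- The block matrix with diagonal blocks `A`, `-A` and identity off-diagonal blocks. -/
def doubleMat (A : Matrix V V ℝ) : Matrix (V × Fin 2) (V × Fin 2) ℝ :=
  A ⊗ₖ !![1, 0; 0, -1] + 1 ⊗ₖ !![0, 1; 1, 0]

lemma SMat.doubleMat (hA : SMat G A) :
    SMat (G.boxProd (⊤ : SimpleGraph (Fin 2))) (doubleMat A) := by
  constructor
  · ext ⟨i, a⟩ ⟨j, b⟩
    have := hA.1.apply i j
    fin_cases a <;> fin_cases b <;> simp [_root_.doubleMat, Matrix.one_apply, this, eq_comm]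
  · rintro ⟨i, a⟩ ⟨j, b⟩ hij
    have := hA.2 i j
    fin_cases a <;> fin_cases b <;>
      simp_all [_root_.doubleMat, SimpleGraph.boxProd_adj, Matrix.one_apply]

lemma doubleMat_sq (A : Matrix V V ℝ) :
    doubleMat A ^ 2 = (A ^ 2 + 1) ⊗ₖ (1 : Matrix (Fin 2) (Fin 2) ℝ) := by
  have h1 : (!![1, 0; 0, -1] * !![1, 0; 0, -1] : Matrix (Fin 2) (Fin 2) ℝ) = 1 := by
    ext i j; fin_cases i <;> fin_cases j <;> simp
  have h2 : (!![0, 1; 1, 0] * !![0, 1; 1, 0] : Matrix (Fin 2) (Fin 2) ℝ) = 1 := by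
    ext i j; fin_cases i <;> fin_cases j <;> simp
  have h3 : (!![1, 0; 0, -1] * !![0, 1; 1, 0] : Matrix (Fin 2) (Fin 2) ℝ) =
      -(!![0, 1; 1, 0] * !![1, 0; 0, -1]) := by
    ext i j; fin_cases i <;> fin_cases j <;> simp
  have h4 : A ⊗ₖ (-(!![0, 1; 1, 0] * !![1, 0; 0, -1]) : Matrix (Fin 2) (Fin 2) ℝ) =
      -(A ⊗ₖ (!![0, 1; 1, 0] * !![1, 0; 0, -1] : Matrix (Fin 2) (Fin 2) ℝ)) := by
    ext; simp only [Matrix.kroneckerMap_apply, Matrix.neg_apply, mul_neg]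
  rw [doubleMat, sq, sq, add_mul, mul_add, mul_add]
  simp only [← Matrix.mul_kronecker_mul, h1, h2, h3, h4, mul_one, one_mul, Matrix.add_kronecker]
  abel

lemma spectrum_kronecker_one_subset {W : Type*} [Fintype W] [DecidableEq W] (A : Matrix V V ℝ) :
    spectrum ℝ (A ⊗ₖ (1 : Matrix W W ℝ)) ⊆ spectrum ℝ A := by
  intro c
  contrapose
  rw [spectrum.notMem_iff, spectrum.notMem_iff]
  rintro ⟨u, hu⟩
  have hc : algebraMap ℝ (Matrix (V × W) (V × W) ℝ) c - A ⊗ₖ (1 : Matrix W W ℝ) =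
      (u : Matrix V V ℝ) ⊗ₖ (1 : Matrix W W ℝ) := by
    rw [hu, sub_eq_iff_eq_add, ← Matrix.add_kronecker, sub_add_cancel,
      Algebra.algebraMap_eq_smul_one, Algebra.algebraMap_eq_smul_one,
      Matrix.smul_kronecker, Matrix.one_kronecker_one]
  rw [hc, Matrix.isUnit_iff_isUnit_det, Matrix.det_kronecker, Matrix.det_one, one_pow, mul_one]
  exact ((Matrix.isUnit_iff_isUnit_det _).1 u.isUnit).pow _

lemma spectrum_doubleMat_subset (hA : IsSelfAdjoint A) :
    spectrum ℝ (doubleMat A) ⊆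
      (fun x => √(x ^ 2 + 1)) '' spectrum ℝ A ∪ (fun x => -√(x ^ 2 + 1)) '' spectrum ℝ A := by
  intro μ hμ
  have h1 : μ ^ 2 ∈ spectrum ℝ (A ^ 2 + 1) := by
    have := spectrum.pow_mem_pow (doubleMat A) 2 hμ
    rw [doubleMat_sq] at this
    exact spectrum_kronecker_one_subset _ this
  have h2 : cfc (fun x : ℝ => x ^ 2 + 1) A = A ^ 2 + 1 := by
    rw [cfc_add_const (1 : ℝ) (fun x => x ^ 2) A, cfc_pow_id A 2, map_one]
  rw [← h2, cfc_map_spectrum (fun x : ℝ => x ^ 2 + 1) A] at h1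
  obtain ⟨x, hx, hxμ⟩ := h1
  have habs : √(x ^ 2 + 1) = |μ| := by
    rw [← Real.sqrt_sq_eq_abs]
    exact congrArg _ hxμ
  rcases abs_choice μ with h | h
  · exact Or.inl ⟨x, hx, habs.trans h⟩
  · exact Or.inr ⟨x, hx, by simp [habs, h]⟩

end SymmetricMatrices

lemma Set.ncard_image_lt_of_eq {α β : Type*} {s : Set α} (hs : s.Finite) (f : α → β) {x y : α}
    (hx : x ∈ s) (hy : y ∈ s) (hxy : x ≠ y) (hf : f x = f y) : (f '' s).ncard < s.ncard :=
  (Set.ncard_image_le hs).lt_of_ne fun h =>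
    hxy ((Set.ncard_image_iff hs).1 h hx hy hf)

/-- For a graph `G` with at least one edge, `q(G □ K_2) ≤ 2 q(G) - 2`. -/
theorem stmt_17 {V : Type*} [Fintype V] [DecidableEq V] (G : SimpleGraph V)
    (h : G.edgeSet.Nonempty) :
    qGraph (G.boxProd (⊤ : SimpleGraph (Fin 2))) ≤ 2 * qGraph G - 2 := by
  obtain ⟨A₀, hA₀, hq⟩ := exists_qMat_eq_qGraph G
  obtain ⟨x, hx, y, hy, hxy⟩ := hA₀.spectrum_nontrivial h
  set c : ℝ := (x + y) / 2 with hc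
  set A := A₀ - algebraMap ℝ (Matrix V V ℝ) c with hA_def
  have hA : SMat G A := hA₀.sub_algebraMap c
  have hmem {z : ℝ} : z - c ∈ spectrum ℝ A ↔ z ∈ spectrum ℝ A₀ := by
    rw [spectrum.mem_iff, spectrum.mem_iff, hA_def, map_sub, sub_sub_sub_cancel_right]
  have hspec : spectrum ℝ A = (fun z => z - c) '' spectrum ℝ A₀ := by
    ext z
    refine ⟨fun hz => ⟨z + c, hmem.1 (by simpa using hz), by simp⟩, ?_⟩
    rintro ⟨w, hw, rfl⟩
    exact hmem.2 hw
  have hcard : (spectrum ℝ A).ncard = qGraph G := by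
    rw [hspec, Set.ncard_image_of_injective _ (sub_left_injective), ← hq, qMat]
  have hfin : (spectrum ℝ A).Finite := Matrix.finite_real_spectrum
  have hne : x - c ≠ y - c := fun e => hxy (sub_left_injective e)
  have hsq : (x - c) ^ 2 = (y - c) ^ 2 := by rw [hc]; ring
  have h1 := Set.ncard_image_lt_of_eq hfin (fun x => √(x ^ 2 + 1)) (hmem.2 hx) (hmem.2 hy) hne
    (by simp only [hsq])
  have h2 := Set.ncard_image_lt_of_eq hfin (fun x => -√(x ^ 2 + 1)) (hmem.2 hx) (hmem.2 hy) hne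
    (by simp only [hsq])
  have h3 := (Set.ncard_le_ncard (spectrum_doubleMat_subset hA.isSelfAdjoint)
    ((hfin.image _).union (hfin.image _))).trans (Set.ncard_union_le _ _)
  have h4 : qGraph _ ≤ (spectrum ℝ (doubleMat A)).ncard := qGraph_le hA.doubleMat
  omega
end
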